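/- arXiv:2508.08119 — 2 statements merged into one kernel-verified Lean document; each statement's English description precedes it below -/
import Mathlib

section
/- Let G be a finite simple graph, let k ≥ 1 be an integer, and let x be a vertex of G. Then either (1) there exist k pairwise edge-disjoint odd x-circuits in G, or (2) there exists a set X ⊆ E(G) of size at most 2k − 2 such that every x-circuit in the graph obtained from G by deleting the edges in X has even length. -/
open SimpleGraph

/-- An immersion of `H` in `G`: an injection `φ` of the vertices of `H` into `G`
(the branch vertices), together with, for each edge `uv` of `H`, a trail in `G`
from `φ u` to `φ v` (the branch trails), such that the branch trails are
pairwise edge-disjoint.  The trail assigned to the reversed adjacency is the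
reversed trail, so there is one branch trail per edge of `H`. -/
structure Immersion {V : Type*} {W : Type*} (G : SimpleGraph V) (H : SimpleGraph W) where
  φ : W ↪ V
  trail : ∀ ⦃u v : W⦄, H.Adj u v → G.Walk (φ u) (φ v)
  isTrail : ∀ ⦃u v : W⦄ (h : H.Adj u v), (trail h).IsTrail
  symm : ∀ ⦃u v : W⦄ (h : H.Adj u v), trail h.symm = (trail h).reverse
  disjoint : ∀ ⦃u v a b : W⦄ (h₁ : H.Adj u v) (h₂ : H.Adj a b),
      s(u, v) ≠ s(a, b) → List.Disjoint (trail h₁).edges (trail h₂).edges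

/-- `G` admits an immersion of `H`. -/
def HasImmersion {V W : Type*} (G : SimpleGraph V) (H : SimpleGraph W) : Prop :=
  Nonempty (Immersion G H)

/-- `G` admits a totally odd immersion of `H`: every branch trail has odd length. -/
def HasTotallyOddImmersion {V W : Type*} (G : SimpleGraph V) (H : SimpleGraph W) : Prop :=
  ∃ I : Immersion G H, ∀ ⦃u v : W⦄ (h : H.Adj u v), Odd (I.trail h).length

/-- `G` admits a totally even immersion of `H`: every branch trail has even length. -/
def HasTotallyEvenImmersion {V W : Type*} (G : SimpleGraph V) (H : SimpleGraph W) : Prop :=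
  ∃ I : Immersion G H, ∀ ⦃u v : W⦄ (h : H.Adj u v), Even (I.trail h).length

/-- An x-circuit: a closed trail of positive length from x to x in which x does not
occur as an internal vertex. -/
def IsXCircuit {V : Type*} {G : SimpleGraph V} {x : V} (c : G.Walk x x) : Prop :=
  c.IsTrail ∧ 0 < c.length ∧ ∀ i, 0 < i → i < c.length → c.getVert i ≠ x


universe u
theorem xc_tutte {W : Type u} [Finite W] (H : SimpleGraph W)
    (h : ∀ M : H.Subgraph, ¬ M.IsPerfectMatching) (he : Even (Nat.card W)) :
    ∃ (U : Set W) (ι : Type u) (_ : Finite ι) (comp : W → ι) (O : Set ι),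
      (∀ w w', w ∉ U → w' ∉ U → H.Adj w w' → comp w = comp w') ∧
      (∀ c ∈ O, Odd {w | w ∉ U ∧ comp w = c}.ncard) ∧ U.ncard + 2 ≤ O.ncard := by
  classical
  obtain ⟨U, hU⟩ := exists_isTutteViolator h he
  unfold IsTutteViolator at hU
  set K := ((⊤ : H.Subgraph).deleteVerts U) with hK
  have hv : ∀ w, w ∈ K.verts ↔ w ∉ U := by intro w; simp [hK]
  refine ⟨U, Option K.coe.ConnectedComponent, inferInstance,
    fun w => if hw : w ∈ K.verts then some (K.coe.connectedComponentMk ⟨w, hw⟩) else none,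
    some '' K.coe.oddComponents, ?_, ?_, ?_⟩
  · intro w w' hw hw' ha
    have h1 := (hv w).2 hw
    have h2 := (hv w').2 hw'
    simp only [h1, h2, dif_pos]
    refine congrArg some ?_
    apply ConnectedComponent.connectedComponentMk_eq_of_adj
    simp [hK, hw, hw', ha]
  · rintro _ ⟨c, hc, rfl⟩
    have : {w | w ∉ U ∧ (if hw : w ∈ K.verts then some (K.coe.connectedComponentMk ⟨w, hw⟩) else none) = some c} = Subtype.val '' c.supp := by
      ext w
      simp only [Set.mem_setOf_eq, Set.mem_image, Subtype.exists, exists_and_right, exists_eq_right, ConnectedComponent.mem_supp_iff]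
      constructor
      · rintro ⟨h1, h2⟩
        have h3 := (hv w).2 h1
        refine ⟨h3, ?_⟩
        simpa [h3] using h2
      · rintro ⟨h3, h2⟩
        exact ⟨(hv w).1 h3, by simp [h3, h2]⟩
    rw [this, Set.ncard_image_of_injective _ Subtype.val_injective]
    exact hc
  · rw [Set.ncard_image_of_injective _ (Option.some_injective _)]
    have hp := odd_ncard_oddComponents (G := K.coe)
    have hc : Nat.card K.verts + U.ncard = Nat.card W := by
      have : K.verts = Uᶜ := by ext w; simp [hv]
      rw [this, Nat.card_coe_set_eq, add_comm]; exact Set.ncard_add_ncard_compl U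
    rcases Nat.even_or_odd (K.coe.oddComponents.ncard) with h1 | h1
    · have h2 : ¬ Odd (Nat.card K.verts) := fun h => by
        have := hp.2 h
        exact Nat.not_even_iff_odd.2 this h1
      rw [Nat.not_odd_iff_even] at h2
      grind
    · have h2 := hp.1 h1
      grind

theorem xc_even {W : Type*} [Finite W] (S : Set W) (g : W → W) (hg : ∀ w, g (g w) = w)
    (hS : ∀ w ∈ S, g w ∈ S) (hf : ∀ w ∈ S, g w ≠ w) : Even S.ncard := by
  classical
  cases nonempty_fintype W
  rw [Set.ncard_eq_toFinset_card']
  have := Finset.sum_involution (s := S.toFinset) (f := fun _ => (1 : ZMod 2)) (fun w _ => g w)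
    (by intro a _; decide) (by intro a ha _; exact hf a (by simpa using ha))
    (by intro a ha; simpa using hS a (by simpa using ha)) (by intro a _; exact hg a)
  simp only [Finset.sum_const, nsmul_eq_mul, mul_one] at this
  rw [ZMod.natCast_eq_zero_iff] at this
  exact even_iff_two_dvd.2 this

theorem xc_half {W : Type*} [Finite W] (S : Finset W) (p : W → W) (hp : ∀ w ∈ S, p (p w) = w)
    (hS : ∀ w ∈ S, p w ∈ S) (hf : ∀ w ∈ S, p w ≠ w) (k : ℕ) (hk : 2 * k ≤ S.card) :
    ∃ a : Fin k → W, (∀ i, a i ∈ S) ∧ ∀ i j, i ≠ j → a i ≠ a j ∧ a i ≠ p (a j) := by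
  classical
  obtain ⟨n, ⟨e⟩⟩ := Finite.exists_equiv_fin W
  let R := S.filter (fun w => e w < e (p w))
  have h1 : S ⊆ R ∪ R.image p := by
    intro w hw
    rcases lt_trichotomy (e w) (e (p w)) with h | h | h
    · simp [R, hw, h]
    · exact absurd (e.injective h).symm (hf w hw)
    · simp only [Finset.mem_union, Finset.mem_image]
      refine Or.inr ⟨p w, ?_, hp w hw⟩
      simp [R, hS w hw, hp w hw, h]
  have h2 := Finset.card_le_card h1
  have h3 := Finset.card_union_le R (R.image p)
  have h4 : (R.image p).card ≤ R.card := Finset.card_image_le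
  have h5 : k ≤ R.card := by omega
  obtain ⟨R', hR', hc⟩ := Finset.exists_subset_card_eq h5
  let b := R'.equivFinOfCardEq hc
  have hb : ∀ i, (b.symm i : W) ∈ R := fun i => hR' (b.symm i).2
  refine ⟨fun i => b.symm i, fun i => (Finset.mem_filter.1 (hb i)).1, ?_⟩
  intro i j hij
  constructor
  · intro h; exact hij (b.symm.injective (Subtype.ext h))
  · intro h
    have hi := Finset.mem_filter.1 (hb i)
    have hj := Finset.mem_filter.1 (hb j)
    have h6 := hi.2
    have h7 := hj.2
    change (b.symm i : W) = p (b.symm j) at h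
    rw [h, hp _ hj.1] at h6
    exact lt_asymm h6 h7

section
variable {W : Type*} (f g : W → W)

theorem xc_conj (hf : ∀ w, f (f w) = w) (hg : ∀ w, g (g w) = w) (i : ℕ) (w : W) :
    (g ∘ f)^[i] (g ((g ∘ f)^[i] w)) = g w := by
  induction i generalizing w with
  | zero => rfl
  | succ i ih =>
    rw [Function.iterate_succ_apply (g ∘ f) i w, Function.iterate_succ_apply', ih]
    simp [hf, hg]

/-- The structure of the orbit of a fixed point of `g` under two involutions. -/
theorem xc_orbit [Finite W] (hf : ∀ w, f (f w) = w) (hg : ∀ w, g (g w) = w)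
    (hff : ∀ w, f w ≠ w) (a : W) (ha : g a = a) :
    ∃ m : ℕ, 1 ≤ m ∧ (∀ i, g ((g ∘ f)^[i] a) = (g ∘ f)^[i] a ↔ m ∣ i) ∧
      (∀ i j, (g ∘ f)^[i] a = (g ∘ f)^[j] a ↔ i ≡ j [MOD 2 * m]) ∧
      (∀ i j, g ((g ∘ f)^[i] a) = (g ∘ f)^[j] a ↔ 2 * m ∣ i + j) := by
  set t := g ∘ f with ht
  have hinj : Function.Injective t := by
    intro u v h
    simp only [ht, Function.comp] at h
    have := congrArg g h
    rw [hg, hg] at this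
    have := congrArg f this
    rwa [hf, hf] at this
  have hper : a ∈ Function.periodicPts t := by
    exact hinj.mem_periodicPts a
  set N := Function.minimalPeriod t a with hN
  have hNpos : 0 < N := Function.minimalPeriod_pos_of_mem_periodicPts hper
  have h1 : ∀ i, t^[i] a = a ↔ N ∣ i := fun i => Function.isPeriodicPt_iff_minimalPeriod_dvd
  have h3 : ∀ i j, g (t^[i] a) = t^[j] a ↔ N ∣ i + j := by
    intro i j
    rw [← h1, Function.iterate_add_apply, ← (hinj.iterate i).eq_iff, xc_conj f g hf hg, ha, eq_comm]
  have hodd : ∀ j, ¬ N ∣ 2 * j + 1 := by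
    intro j hj
    have h4 := (h3 (j+1) j).2 (by convert hj using 1; ring)
    rw [Function.iterate_succ_apply'] at h4
    simp only [ht, Function.comp] at h4
    rw [hg] at h4
    exact hff _ h4
  have hev : ∃ m, N = 2 * m := by
    rcases Nat.even_or_odd' N with ⟨c, hc | hc⟩
    · exact ⟨c, hc⟩
    · exact absurd (by rw [hc]) (hodd c)
  obtain ⟨m, hm⟩ := hev
  refine ⟨m, by omega, ?_, ?_, ?_⟩
  · intro i
    rw [h3, hm, ← two_mul, Nat.mul_dvd_mul_iff_left (by norm_num)]
  · intro i j
    rw [← hm]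
    rw [← Function.iterate_mod_minimalPeriod_eq (n := i),
      ← Function.iterate_mod_minimalPeriod_eq (n := j),
      Function.iterate_eq_iterate_iff_of_lt_minimalPeriod (Nat.mod_lt _ hNpos)
        (Nat.mod_lt _ hNpos)]
    rfl
  · intro i j; rw [← hm]; exact h3 i j

theorem xc_pairing [Finite W] (hf : ∀ w, f (f w) = w) (hg : ∀ w, g (g w) = w)
    (hff : ∀ w, f w ≠ w) :
    ∃ m : W → ℕ, ∀ a, g a = a →
      1 ≤ m a ∧ g ((g ∘ f)^[m a] a) = (g ∘ f)^[m a] a ∧ (g ∘ f)^[m a] a ≠ a ∧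
      (g ∘ f)^[m ((g ∘ f)^[m a] a)] ((g ∘ f)^[m a] a) = a ∧
      (∀ i, 0 < i → i < m a → g ((g ∘ f)^[i] a) ≠ (g ∘ f)^[i] a) ∧
      (∀ i j, i ≤ m a → j ≤ m a → ((g ∘ f)^[i] a = (g ∘ f)^[j] a ∨
        g ((g ∘ f)^[i] a) = (g ∘ f)^[j] a) → i = j) ∧
      (∀ a' i j, g a' = a' → ((g ∘ f)^[i] a = (g ∘ f)^[j] a' ∨
        g ((g ∘ f)^[i] a) = (g ∘ f)^[j] a') → a' = a ∨ a' = (g ∘ f)^[m a] a) := by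
  choose! m hm1 hm2 hm3 hm4 using fun a => xc_orbit f g hf hg hff a
  refine ⟨m, fun a ha => ?_⟩
  have hcross : ∀ a, g a = a → ∀ a' i j, g a' = a' → (g ∘ f)^[i] a = (g ∘ f)^[j] a' →
      a' = a ∨ a' = (g ∘ f)^[m a] a := by
    intro a ha a' i j ha' h
    have h1 : ∃ s, (g ∘ f)^[s] a = a' := by
      have h2 : (g ∘ f)^[(2 * m a' * j - j) + j] a' = (g ∘ f)^[0] a' := by
        rw [hm3 a' ha']
        have : j ≤ 2 * m a' * j := Nat.le_mul_of_pos_left _ (by have := hm1 a' ha'; omega)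
        rw [Nat.sub_add_cancel this]
        exact (Nat.modEq_zero_iff_dvd).2 (Dvd.intro _ rfl)
      rw [Function.iterate_add_apply, ← h, ← Function.iterate_add_apply] at h2
      exact ⟨_, h2⟩
    obtain ⟨s, rfl⟩ := h1
    obtain ⟨c, hc⟩ := (hm2 a ha s).1 ha'
    rcases Nat.even_or_odd' c with ⟨e, he | he⟩
    · left
      refine (hm3 a ha s 0).2 ?_
      rw [hc, he]
      exact (Nat.modEq_zero_iff_dvd).2 ⟨e, by ring⟩
    · right
      refine (hm3 a ha s (m a)).2 ?_
      rw [hc, he]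
      have : m a * (2 * e + 1) = m a + 2 * m a * e := by ring
      rw [this]
      simp [Nat.ModEq]
  have hfix : g ((g ∘ f)^[m a] a) = (g ∘ f)^[m a] a := (hm2 a ha _).2 dvd_rfl
  have hne : (g ∘ f)^[m a] a ≠ a := by
    intro h
    have h1 := (hm3 a ha (m a) 0).1 h
    have h2 := hm1 a ha
    have h3 := Nat.le_of_dvd (by omega) ((Nat.modEq_zero_iff_dvd).1 h1)
    omega
  refine ⟨hm1 a ha, hfix, hne, ?_, ?_, ?_, ?_⟩
  · have h2 : (g ∘ f)^[m a + m a] a = (g ∘ f)^[0] a := by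
      rw [hm3 a ha, ← two_mul]; exact (Nat.modEq_zero_iff_dvd).2 dvd_rfl
    rw [Function.iterate_add_apply] at h2
    rcases hcross _ hfix a _ 0 ha h2 with h | h
    · exact absurd h.symm hne
    · exact h.symm
  · intro i hi hi' h
    have := Nat.le_of_dvd hi ((hm2 a ha i).1 h)
    omega
  · rintro i j hi hj (h | h)
    · have h1 := (hm3 a ha i j).1 h
      have h2 := hm1 a ha
      unfold Nat.ModEq at h1
      rwa [Nat.mod_eq_of_lt (by omega), Nat.mod_eq_of_lt (by omega)] at h1
    · obtain ⟨c, hc⟩ := (hm4 a ha i j).1 h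
      have h2 := hm1 a ha
      rcases c with _ | _ | c
      · omega
      · omega
      · have : 2 * m a * (c + 1 + 1) = 2 * m a + 2 * m a + 2 * m a * c := by ring
        rw [this] at hc
        generalize 2 * m a * c = z at hc
        omega
  · rintro a' i j ha' (h | h)
    · exact hcross a ha a' i j ha' h
    · have h5 : g ((g ∘ f)^[i] a) = (g ∘ f)^[2 * m a * i - i] a := by
        rw [hm4 a ha]
        have : i ≤ 2 * m a * i := Nat.le_mul_of_pos_left _ (by have := hm1 a ha; omega)
        rw [Nat.add_sub_cancel' this]
        exact Dvd.intro _ rfl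
      rw [h5] at h
      exact hcross a ha a' _ j ha' h
end

theorem xc_concat {V : Type*} {G : SimpleGraph V} {x v w : V} (P : G.Walk x v) (h : G.Adj v w)
    (hP : P.IsTrail) (he : s(v, w) ∉ P.edges)
    (hx : ∀ j, 0 < j → j ≤ P.length → P.getVert j ≠ x) :
    (P.concat h).IsTrail ∧ (∀ j, 0 < j → j < (P.concat h).length → (P.concat h).getVert j ≠ x) := by
  constructor
  · rw [SimpleGraph.Walk.isTrail_def, SimpleGraph.Walk.edges_concat]
    rw [SimpleGraph.Walk.isTrail_def] at hP
    simp [List.nodup_append, List.concat_eq_append, hP]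
    intro a ha h'
    exact he (h' ▸ ha)
  · intro j hj hj'
    rw [SimpleGraph.Walk.length_concat] at hj'
    rw [SimpleGraph.Walk.concat_eq_append, SimpleGraph.Walk.getVert_append', if_pos (by omega)]
    exact hx j hj (by omega)

def XCGood {V : Type*} (G : SimpleGraph V) (x : V) (S : Set (Sym2 V)) (b : ℕ) (v : V) : Prop :=
  ∃ P : G.Walk x v, P.IsTrail ∧ (∀ e ∈ P.edges, e ∈ S) ∧
    (∀ j, 0 < j → j ≤ P.length → P.getVert j ≠ x) ∧ P.length % 2 = b

theorem XCGood.mono {V : Type*} {G : SimpleGraph V} {x v : V} {S S' : Set (Sym2 V)} {b : ℕ}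
    (h : XCGood G x S b v) (hS : S ⊆ S') : XCGood G x S' b v := by
  obtain ⟨P, h1, h2, h3, h4⟩ := h
  exact ⟨P, h1, fun e he => hS (h2 e he), h3, h4⟩

theorem XCGood.step {V : Type*} {G : SimpleGraph V} {x v w : V} {S S' : Set (Sym2 V)} {b : ℕ}
    (h : XCGood G x S b v) (hS : S ⊆ S') (ha : G.Adj v w) (h1 : s(v, w) ∉ S) (h2 : s(v, w) ∈ S')
    (hw : w ≠ x) : XCGood G x S' ((b + 1) % 2) w := by
  obtain ⟨P, p1, p2, p3, p4⟩ := h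
  have hc := xc_concat P ha p1 (fun h => h1 (p2 _ h)) p3
  refine ⟨P.concat ha, hc.1, ?_, ?_, ?_⟩
  · intro e he
    simp only [SimpleGraph.Walk.edges_concat, List.concat_eq_append, List.mem_append,
      List.mem_singleton] at he
    rcases he with he | rfl
    · exact hS (p2 _ he)
    · exact h2
  · intro j hj hj'
    rcases Nat.lt_or_ge j (P.concat ha).length with h | h
    · exact hc.2 j hj h
    · rw [SimpleGraph.Walk.getVert_of_length_le _ h]; exact hw
  · rw [SimpleGraph.Walk.length_concat]; omega

theorem xc_walk {V : Type*} {G : SimpleGraph V} {x : V} (n : ℕ) (t : ℕ → G.Dart)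
    (h0 : (t 0).snd = x) (hn : (t (n + 1)).snd = x) (hfst : ∀ i ≤ n + 1, (t i).fst ≠ x)
    (hsnd : ∀ i, 0 < i → i ≤ n → (t i).snd ≠ x)
    (hadj : ∀ i < n, (t i).snd = (t (i + 1)).snd ∨ (t i).fst = (t (i + 1)).fst)
    (hlast : (t n).snd = (t (n + 1)).fst)
    (hinj : ∀ i j, i ≤ n + 1 → j ≤ n + 1 → (t i).edge = (t j).edge → i = j) :
    ∃ c : G.Walk x x, IsXCircuit c ∧ Odd c.length ∧ ∀ e ∈ c.edges, ∃ i ≤ n + 1, e = (t i).edge := by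
  let S : ℕ → Set (Sym2 V) := fun i => {e | ∃ j < i, e = (t j).edge}
  have hSS : ∀ i, S i ⊆ S (i + 1) := by
    rintro i e ⟨j, hj, rfl⟩; exact ⟨j, by omega, rfl⟩
  have hnot : ∀ i ≤ n + 1, (t i).edge ∉ S i := by
    rintro i hi ⟨j, hj, h⟩
    have := hinj i j hi (by omega) h
    omega
  have hin : ∀ i, (t i).edge ∈ S (i + 1) := fun i => ⟨i, by omega, rfl⟩
  have he1 : ∀ i, s((t i).fst, (t i).snd) = (t i).edge := fun i => rfl
  have he2 : ∀ i, s((t i).snd, (t i).fst) = (t i).edge := fun i => Sym2.eq_swap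
  have key : ∀ i ≤ n, XCGood G x (S i) 1 (t i).fst ∨ XCGood G x (S i) 0 (t i).snd := by
    intro i
    induction i with
    | zero =>
      intro _
      right
      rw [h0]
      refine ⟨SimpleGraph.Walk.nil, ?_, ?_, ?_, ?_⟩ <;> simp
      intro j hj hj'; omega
    | succ i ih =>
      intro hi
      have hgo : ∀ hx : 0 < i → (t i).snd ≠ x, True := fun _ => trivial
      rcases ih (by omega) with h | h <;> rcases hadj i (by omega) with h' | h'
      · right
        rw [← h']
        refine h.step (hSS i) (t i).adj ?_ ?_ ?_
        · rw [he1]; exact hnot i (by omega)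
        · rw [he1]; exact hin i
        · rw [h']; exact hsnd _ (by omega) (by omega)
      · left
        rw [← h']; exact h.mono (hSS i)
      · right
        rw [← h']; exact h.mono (hSS i)
      · left
        rw [← h']
        refine h.step (hSS i) (t i).adj.symm ?_ ?_ ?_
        · rw [he2]; exact hnot i (by omega)
        · rw [he2]; exact hin i
        · exact hfst _ (by omega)
  have key2 : XCGood G x (S (n + 1)) 0 (t (n + 1)).fst := by
    rw [← hlast]
    rcases key n le_rfl with h | h
    · refine h.step (hSS n) (t n).adj ?_ ?_ ?_
      · rw [he1]; exact hnot n (by omega)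
      · rw [he1]; exact hin n
      · rw [hlast]; exact hfst _ le_rfl
    · exact h.mono (hSS n)
  obtain ⟨P, p1, p2, p3, p4⟩ := key2
  have ha : G.Adj (t (n + 1)).fst x := by
    have := (t (n + 1)).adj; rwa [hn] at this
  have hee : s((t (n + 1)).fst, x) = (t (n + 1)).edge := by rw [← he1, hn]
  have hc := xc_concat P ha p1 (fun h => hnot (n + 1) le_rfl (by
    rw [← hee]; exact p2 _ h)) p3
  refine ⟨P.concat ha, ⟨hc.1, by simp, hc.2⟩, ?_, ?_⟩
  · rw [SimpleGraph.Walk.length_concat, Nat.odd_iff]; omega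
  · intro e he
    simp only [SimpleGraph.Walk.edges_concat, List.concat_eq_append, List.mem_append,
      List.mem_singleton] at he
    rcases he with he | rfl
    · obtain ⟨j, hj, h⟩ := p2 _ he
      exact ⟨j, by omega, h⟩
    · exact ⟨n + 1, le_rfl, hee⟩

abbrev XD {V : Type*} (G : SimpleGraph V) (x : V) := {d : G.Dart // d.fst ≠ x}

open Classical in
noncomputable def xcG {V : Type*} {G : SimpleGraph V} {x : V} (d : XD G x) : XD G x :=
  if h : d.1.snd = x then d else ⟨d.1.symm, h⟩

theorem xcG_pos {V : Type*} {G : SimpleGraph V} {x : V} {d : XD G x} (h : d.1.snd = x) :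
    xcG d = d := by simp [xcG, h]

theorem xcG_neg {V : Type*} {G : SimpleGraph V} {x : V} {d : XD G x} (h : d.1.snd ≠ x) :
    (xcG d).1 = d.1.symm := by simp [xcG, h]

theorem xcG_invol {V : Type*} {G : SimpleGraph V} {x : V} (d : XD G x) : xcG (xcG d) = d := by
  by_cases h : d.1.snd = x
  · rw [xcG_pos h, xcG_pos h]
  · apply Subtype.ext
    have h1 := xcG_neg h
    rw [xcG_neg, h1]
    · simp
    · rw [h1]; exact d.2

theorem xcG_fix {V : Type*} {G : SimpleGraph V} {x : V} {d : XD G x} :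
    xcG d = d ↔ d.1.snd = x := by
  constructor
  · intro h
    by_contra h'
    have h1 := xcG_neg h'
    rw [h] at h1
    exact d.1.symm_ne h1.symm
  · exact xcG_pos

theorem xcG_edge {V : Type*} {G : SimpleGraph V} {x : V} {d d' : XD G x}
    (h : d.1.edge = d'.1.edge) : d = d' ∨ xcG d = d' := by
  rcases (SimpleGraph.dart_edge_eq_iff _ _).1 h with h | h
  · exact Or.inl (Subtype.ext h)
  · right
    have : d.1.snd ≠ x := by rw [h]; exact d'.2
    apply Subtype.ext
    rw [xcG_neg this, h]; simp

noncomputable def xcGW {V : Type*} {G : SimpleGraph V} {x : V} {n : ℕ} :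
    XD G x ⊕ Fin n → XD G x ⊕ Fin n := Sum.map xcG id

theorem xcGW_invol {V : Type*} {G : SimpleGraph V} {x : V} {n : ℕ} (w : XD G x ⊕ Fin n) :
    xcGW (xcGW w) = w := by
  rcases w with d | i
  · simp [xcGW, xcG_invol]
  · rfl

def XCH {V : Type*} (G : SimpleGraph V) (x : V) (n : ℕ) : SimpleGraph (XD G x ⊕ Fin n) where
  Adj w w' := match w, w' with
    | Sum.inl d, Sum.inl d' => d.1.snd = d'.1.fst ∨ d'.1.snd = d.1.fst
    | Sum.inl _, Sum.inr _ => True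
    | Sum.inr _, Sum.inl _ => True
    | Sum.inr i, Sum.inr j => i ≠ j
  symm := ⟨by
    rintro (d | i) (d' | j) h
    · exact Or.symm h
    · trivial
    · trivial
    · exact Ne.symm h⟩
  loopless := ⟨by
    rintro (d | i) h
    · rcases h with h | h <;> exact d.1.adj.ne h.symm
    · exact h rfl⟩

theorem XCH_inl {V : Type*} {G : SimpleGraph V} {x : V} {n : ℕ} {d d' : XD G x} :
    (XCH G x n).Adj (Sum.inl d) (Sum.inl d') ↔ (d.1.snd = d'.1.fst ∨ d'.1.snd = d.1.fst) := Iff.rfl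

theorem xc_pack {V : Type*} [Finite V] (G : SimpleGraph V) (x : V) (n k : ℕ)
    (hcard : {d : XD G x | d.1.snd = x}.ncard = 2 * k + n)
    (M : (XCH G x n).Subgraph) (hM : M.IsPerfectMatching) :
    ∃ f : Fin k → G.Walk x x, (∀ i, IsXCircuit (f i) ∧ Odd (f i).length) ∧
      ∀ i j, i ≠ j → List.Disjoint (f i).edges (f j).edges := by
  classical
  have : Finite G.Dart := Finite.of_injective (fun d : G.Dart => d.toProd)
    (SimpleGraph.Dart.toProd_injective)
  cases nonempty_fintype (XD G x)
  rw [SimpleGraph.Subgraph.isPerfectMatching_iff] at hM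
  choose f hf hfu using hM
  have hfH : ∀ w, (XCH G x n).Adj w (f w) := fun w => (hf w).adj_sub
  have hff : ∀ w, f (f w) = w := fun w => (hfu (f w) w (hf w).symm).symm
  have hfne : ∀ w, f w ≠ w := fun w h => by
    have := hfH w
    rw [h] at this
    exact this.ne rfl
  obtain ⟨m, hm⟩ := xc_pairing f (xcGW (n := n)) hff xcGW_invol hfne
  set T : (XD G x ⊕ Fin n) → ℕ → (XD G x ⊕ Fin n) := fun a i => (xcGW ∘ f)^[i] a with hT
  set π : (XD G x ⊕ Fin n) → (XD G x ⊕ Fin n) := fun a => T a (m a) with hπ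
  -- selecting the good ends
  let F : Finset (XD G x ⊕ Fin n) :=
    (Finset.univ.filter (fun d : XD G x => d.1.snd = x)).image Sum.inl
  have hF : F.card = 2 * k + n := by
    rw [Finset.card_image_of_injective _ Sum.inl_injective, ← hcard, Set.ncard_eq_toFinset_card']
    congr 1
    ext d; simp
  have hFg : ∀ a ∈ F, xcGW a = a := by
    intro a ha
    simp only [F, Finset.mem_image, Finset.mem_filter, Finset.mem_univ, true_and] at ha
    obtain ⟨d, hd, rfl⟩ := ha
    simp [xcGW, xcG_pos hd]
  let S := F.filter (fun a => π a ∈ F)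
  have hgF : ∀ a, xcGW a = a → a ∈ F ∨ ∃ i, a = Sum.inr i := by
    rintro (d | i) h
    · left
      have : xcG d = d := by simpa [xcGW] using h
      simp only [F, Finset.mem_image, Finset.mem_filter, Finset.mem_univ, true_and]
      exact ⟨d, xcG_fix.1 this, rfl⟩
    · exact Or.inr ⟨i, rfl⟩
  have hππ : ∀ a ∈ F, π (π a) = a := fun a ha => (hm a (hFg a ha)).2.2.2.1
  have hS : 2 * k ≤ S.card := by
    have h1 : S.card + (F.filter (fun a => ¬ π a ∈ F)).card = F.card :=
      Finset.card_filter_add_card_filter_not _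
    have h2 : (F.filter (fun a => ¬ π a ∈ F)).card ≤
        ((Finset.univ : Finset (Fin n)).image (Sum.inr : Fin n → XD G x ⊕ Fin n)).card := by
      apply Finset.card_le_card_of_injOn π
      · intro a ha
        have ha' := Finset.mem_filter.1 ha
        rcases hgF (π a) (hm a (hFg a ha'.1)).2.1 with h | ⟨i, h⟩
        · exact absurd h ha'.2
        · simp [h]
      · intro a ha b hb hab
        have ha' := Finset.mem_filter.1 ha
        have hb' := Finset.mem_filter.1 hb
        rw [← hππ a ha'.1, hab, hππ b hb'.1]
    have h3 : ((Finset.univ : Finset (Fin n)).image (Sum.inr : Fin n → XD G x ⊕ Fin n)).card ≤ n := by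
      refine Finset.card_image_le.trans (by simp)
    omega
  obtain ⟨a, haS, hab⟩ := xc_half S π (fun w hw => hππ w (Finset.mem_filter.1 hw).1)
    (fun w hw => by
      have h := Finset.mem_filter.1 hw
      refine Finset.mem_filter.2 ⟨h.2, ?_⟩
      rw [hππ w h.1]; exact h.1)
    (fun w hw => (hm w (hFg w (Finset.mem_filter.1 hw).1)).2.2.1) k hS
  -- the circuit of a good end
  have hcirc : ∀ a ∈ S, ∃ c : G.Walk x x, (IsXCircuit c ∧ Odd c.length) ∧
      ∀ e ∈ c.edges, ∃ i, ∃ d : XD G x, T a i = Sum.inl d ∧ e = d.1.edge := by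
    intro a ha
    have ha' := Finset.mem_filter.1 ha
    obtain ⟨q1, q2, q3, q4, q5, q6, q7⟩ := hm a (hFg a ha'.1)
    obtain ⟨N, hN⟩ : ∃ N, m a = N + 1 := ⟨m a - 1, by omega⟩
    have hFx : ∀ b ∈ F, ∃ d : XD G x, b = Sum.inl d ∧ d.1.snd = x := by
      intro b hb
      simp only [F, Finset.mem_image, Finset.mem_filter, Finset.mem_univ, true_and] at hb
      obtain ⟨d, hd, rfl⟩ := hb
      exact ⟨d, rfl, hd⟩
    obtain ⟨d0, hd0, hd0x⟩ := hFx a ha'.1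
    obtain ⟨dm, hdm, hdmx⟩ := hFx _ ha'.2
    have hex : ∀ i, i ≤ m a → ∃ d : XD G x, T a i = Sum.inl d := by
      intro i hi
      rcases Nat.eq_zero_or_pos i with rfl | h0
      · exact ⟨d0, hd0⟩
      rcases hi.eq_or_lt with rfl | h1
      · exact ⟨dm, hdm⟩
      have := q5 i h0 h1
      rcases h : T a i with d | j
      · exact ⟨d, rfl⟩
      · exfalso
        apply this
        change xcGW (T a i) = T a i
        rw [h]; rfl
    have : Nonempty (XD G x) := ⟨d0⟩
    choose! t ht using hex
    have hstep : ∀ i < m a, t i |>.1.snd = (xcG (t (i + 1))).1.fst ∨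
        (xcG (t (i + 1))).1.snd = (t i).1.fst := by
      intro i hi
      have h1 : f (T a i) = xcGW (T a (i + 1)) := by
        simp only [hT]
        rw [Function.iterate_succ_apply']
        simp [xcGW_invol]
      have h2 := hfH (T a i)
      rw [h1, ht i hi.le, ht (i + 1) hi] at h2
      exact h2
    have h00 : (t 0).1.snd = x := by
      have h1 := ht 0 (by omega)
      have h2 : T a 0 = Sum.inl d0 := hd0
      rw [h2] at h1
      rw [← Sum.inl_injective h1]; exact hd0x
    have hmm : (t (N + 1)).1.snd = x := by
      have h1 := ht (m a) le_rfl
      have h2 : T a (m a) = Sum.inl dm := hdm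
      rw [h2] at h1
      rw [← hN, ← Sum.inl_injective h1]; exact hdmx
    have hinner : ∀ i, 0 < i → i ≤ N → (t i).1.snd ≠ x := by
      intro i h1 h2 h3
      apply q5 i h1 (by omega)
      change xcGW (T a i) = T a i
      rw [ht i (by omega)]
      simp [xcGW, xcG_pos h3]
    obtain ⟨c, c1, c2, c3⟩ := xc_walk N (fun i => (t i).1) h00 hmm (fun i _ => (t i).2) hinner
      (by
        intro i hi
        have := hstep i (by omega)
        rw [xcG_neg (hinner (i + 1) (by omega) (by omega))] at this
        exact this.imp id Eq.symm)
      (by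
        have := hstep N (by omega)
        rw [xcG_pos hmm] at this
        rcases this with h | h
        · exact h
        · rw [hmm] at h; exact absurd h.symm (t N).2)
      (by
        intro i j hi hj h
        apply q6 i j (by omega) (by omega)
        change T a i = T a j ∨ xcGW (T a i) = T a j
        rw [ht i (by omega), ht j (by omega)]
        rcases xcG_edge h with h | h
        · left; rw [h]
        · right; simp [xcGW, h])
    refine ⟨c, ⟨c1, c2⟩, ?_⟩
    intro e he
    obtain ⟨i, hi, h⟩ := c3 e he
    exact ⟨i, t i, ht i (by omega), h⟩
  choose! c hc1 hc2 using hcirc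
  refine ⟨fun i => c (a i), fun i => hc1 _ (haS i), ?_⟩
  intro i j hij e hei hej
  obtain ⟨p, d, hd, hed⟩ := hc2 _ (haS i) e hei
  obtain ⟨q, d', hd', hed'⟩ := hc2 _ (haS j) e hej
  have hgi := hFg _ (Finset.mem_filter.1 (haS i)).1
  have hgj := hFg _ (Finset.mem_filter.1 (haS j)).1
  have h := (hm _ hgi).2.2.2.2.2.2 (a j) p q hgj (by
    change T (a i) p = T (a j) q ∨ xcGW (T (a i) p) = T (a j) q
    rw [hd, hd']
    rcases xcG_edge (hed.symm.trans hed') with h | h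
    · left; rw [h]
    · right; simp [xcGW, h])
  rcases h with h | h
  · exact (hab j i (Ne.symm hij)).1 h
  · exact (hab j i (Ne.symm hij)).2 h

theorem xc_trail_inj {V : Type*} {G : SimpleGraph V} {x y : V} (c : G.Walk x y) (hc : c.IsTrail)
    {i j : ℕ} (hi : i < c.length) (hj : j < c.length)
    (h : s(c.getVert i, c.getVert (i + 1)) = s(c.getVert j, c.getVert (j + 1))) : i = j := by
  have hi' : i < c.edges.length := by simpa using hi
  have hj' : j < c.edges.length := by simpa using hj
  rw [← SimpleGraph.Walk.getElem_edges hi', ← SimpleGraph.Walk.getElem_edges hj'] at h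
  rw [SimpleGraph.Walk.isTrail_def] at hc
  exact (hc.getElem_inj_iff).1 h

theorem xc_finite {V : Type*} [Finite V] (G : SimpleGraph V) : Finite G.Dart :=
  Finite.of_injective (fun d : G.Dart => d.toProd) (SimpleGraph.Dart.toProd_injective)

theorem xc_small {V : Type*} [Finite V] (G : SimpleGraph V) (x : V) (k : ℕ)
    (hcard : {d : XD G x | d.1.snd = x}.ncard < 2 * k) :
    ∃ X ⊆ G.edgeSet, X.ncard ≤ 2 * k - 2 ∧
      ∀ (c : (G.deleteEdges X).Walk x x), IsXCircuit c → Even c.length := by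
  classical
  have := xc_finite G
  set A := {d : XD G x | d.1.snd = x} with hA
  have key : ∀ X : Set (Sym2 V), ∀ (c : (G.deleteEdges X).Walk x x), IsXCircuit c →
      ¬ Even c.length → ∃ a ∈ A, ∃ b ∈ A, a ≠ b ∧ a.1.edge ∉ X ∧ b.1.edge ∉ X := by
    intro X c ⟨h1, h2, h3⟩ hodd
    have hL : c.length ≠ 1 := by
      intro h
      have ha := c.adj_getVert_succ (i := 0) (by omega)
      have e1 : c.getVert (0 + 1) = x := by
        have := c.getVert_length; rwa [h] at this
      rw [e1, c.getVert_zero] at ha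
      exact ha.ne rfl
    obtain ⟨L, hLL⟩ : ∃ L, c.length = L + 2 := ⟨c.length - 2, by omega⟩
    have ha := c.adj_getVert_succ (i := 0) (by omega)
    have hb := c.adj_getVert_succ (i := L + 1) (by omega)
    have e0 : c.getVert 0 = x := c.getVert_zero
    have eL : c.getVert (L + 1 + 1) = x := by
      have := c.getVert_length; rwa [hLL] at this
    rw [SimpleGraph.deleteEdges_adj] at ha hb
    have n1 := h3 (0 + 1) (by omega) (by omega)
    have n2 := h3 (L + 1) (by omega) (by omega)
    refine ⟨⟨⟨(c.getVert (0 + 1), c.getVert 0), ha.1.symm⟩, n1⟩, e0,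
      ⟨⟨(c.getVert (L + 1), c.getVert (L + 1 + 1)), hb.1⟩, n2⟩, eL, ?_, ?_, ?_⟩
    · intro h
      have h4 : s(c.getVert 0, c.getVert (0 + 1)) = s(c.getVert (L + 1), c.getVert (L + 1 + 1)) := by
        have := congrArg (fun d : XD G x => d.1.edge) h
        rw [Sym2.eq_swap]
        exact this
      have := xc_trail_inj c h1 (by omega) (by omega) h4
      omega
    · intro h
      apply ha.2
      rw [Sym2.eq_swap]
      exact h
    · exact hb.2
  rcases A.eq_empty_or_nonempty with h | ⟨a0, ha0⟩
  · refine ⟨∅, by simp, by simp, ?_⟩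
    intro c hc
    by_contra hodd
    obtain ⟨a, ha, -⟩ := key _ c hc hodd
    rw [h] at ha
    exact ha
  · refine ⟨(fun d : XD G x => d.1.edge) '' (A \ {a0}), ?_, ?_, ?_⟩
    · rintro _ ⟨d, -, rfl⟩; exact d.1.edge_mem
    · have h1 := Set.ncard_image_le (f := fun d : XD G x => d.1.edge) (Set.toFinite (A \ {a0}))
      have h2 := Set.ncard_sdiff_singleton_of_mem ha0
      omega
    · intro c hc
      by_contra hodd
      obtain ⟨a, ha, b, hb, hab, h1, h2⟩ := key _ c hc hodd
      have ha' : a = a0 := by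
        by_contra h; exact h1 ⟨a, ⟨ha, h⟩, rfl⟩
      have hb' : b = a0 := by
        by_contra h; exact h2 ⟨b, ⟨hb, h⟩, rfl⟩
      exact hab (ha'.trans hb'.symm)

theorem XCH_adj_g {V : Type*} {G : SimpleGraph V} {x : V} {n : ℕ} (d : XD G x)
    (h : d.1.snd ≠ x) : (XCH G x n).Adj (Sum.inl d) (Sum.inl (xcG d)) := by
  rw [XCH_inl, xcG_neg h]
  left; rfl

theorem xc_hit {V : Type*} [Finite V] (G : SimpleGraph V) (x : V) (n k : ℕ)
    (hcard : {d : XD G x | d.1.snd = x}.ncard = 2 * k + n)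
    (hM : ∀ M : (XCH G x n).Subgraph, ¬ M.IsPerfectMatching) :
    ∃ X ⊆ G.edgeSet, X.ncard ≤ 2 * k - 2 ∧
      ∀ (c : (G.deleteEdges X).Walk x x), IsXCircuit c → Even c.length := by
  classical
  have := xc_finite G
  set A := {d : XD G x | d.1.snd = x} with hA
  have hev : Even (Nat.card (XD G x ⊕ Fin n)) := by
    have h1 : Even (Aᶜ).ncard := by
      refine xc_even Aᶜ xcG xcG_invol ?_ ?_
      · intro w hw
        have hw' : w.1.snd ≠ x := hw
        change (xcG w).1.snd ≠ x
        rw [xcG_neg hw']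
        exact w.2
      · intro w hw h
        exact hw (xcG_fix.1 h)
    have h2 := Set.ncard_add_ncard_compl A
    rw [Nat.card_sum, ← h2, hcard, Nat.card_fin]
    grind
  obtain ⟨U, ι, _, comp, O, hcomp, hO, hOU⟩ := xc_tutte _ hM hev
  have hinr : ∀ j : Fin n, Sum.inr j ∈ U := by
    intro j
    by_contra hj
    have hsub : O ⊆ {comp (Sum.inr j)} := by
      intro c hc
      have h1 := (hO c hc).pos
      have h2 : {w | w ∉ U ∧ comp w = c}.Nonempty := by
        rw [Set.nonempty_iff_ne_empty]
        intro h; rw [h] at h1; simp at h1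
      obtain ⟨w, hw, hwc⟩ := h2
      rw [Set.mem_singleton_iff, ← hwc]
      by_cases he : w = Sum.inr j
      · rw [he]
      · refine hcomp _ _ hw hj ?_
        rcases w with d | i
        · trivial
        · exact fun h => he (by rw [h])
    have := Set.ncard_le_ncard hsub
    rw [Set.ncard_singleton] at this
    omega
  set B : Set (XD G x ⊕ Fin n) := {w | w ∉ U ∧ (xcGW w = w ∨ xcGW w ∈ U)} with hB
  have hOB : ∀ c ∈ O, ∃ w ∈ B, comp w = c := by
    intro c hc
    by_contra! hno
    have hcl : ∀ w, w ∉ U → comp w = c → xcGW w ≠ w ∧ xcGW w ∉ U := by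
      intro w hw hwc
      have h1 : ¬ w ∈ B := fun h => hno w h hwc
      constructor
      · intro h; exact h1 ⟨hw, Or.inl h⟩
      · intro h; exact h1 ⟨hw, Or.inr h⟩
    have := xc_even {w | w ∉ U ∧ comp w = c} xcGW xcGW_invol (by
      rintro w ⟨hw, hwc⟩
      obtain ⟨h1, h2⟩ := hcl w hw hwc
      refine ⟨h2, ?_⟩
      rw [← hwc]
      apply hcomp _ _ h2 hw
      rcases w with d | i
      · refine (XCH_adj_g d ?_).symm
        intro h; apply h1; simp [xcGW, xcG_pos h]
      · exact absurd (hinr i) hw) (fun w hw => (hcl w hw.1 hw.2).1)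
    exact Nat.not_even_iff_odd.2 (hO c hc) this
  have : Nonempty (XD G x ⊕ Fin n) := by
    have h1 : O.Nonempty := by
      rw [Set.nonempty_iff_ne_empty]
      intro h; rw [h] at hOU; simp at hOU
    obtain ⟨c, hc⟩ := h1
    exact ⟨(hOB c hc).choose⟩
  choose! r hrB hrc using hOB
  set R := r '' O with hR
  have hRcard : R.ncard = O.ncard := by
    apply Set.ncard_image_of_injOn
    intro c hc c' hc' h
    rw [← hrc c hc, h, hrc c' hc']
  have hRB : R ⊆ B := by rintro _ ⟨c, hc, rfl⟩; exact hrB c hc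
  have hB' : (B \ R).ncard + R.ncard = B.ncard := Set.ncard_sdiff_add_ncard_of_subset hRB
  set Q : Set (XD G x) := {d | Sum.inl d ∈ U ∧ Sum.inl (xcG d) ∈ U} with hQ
  set B1 : Set (XD G x) := {d | Sum.inl d ∈ B \ R} with hB1
  -- counting
  set N1 : Set (XD G x ⊕ Fin n) := {w | w ∈ U ∧ xcGW w ∉ U} with hN1
  have hc1 : Q.ncard + n + N1.ncard ≤ U.ncard := by
    have e1 : (Sum.inl '' Q : Set (XD G x ⊕ Fin n)).ncard = Q.ncard :=
      Set.ncard_image_of_injective _ Sum.inl_injective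
    have e2 : (Set.range Sum.inr : Set (XD G x ⊕ Fin n)).ncard = n := by
      rw [← Set.image_univ, Set.ncard_image_of_injective _ Sum.inr_injective, Set.ncard_univ,
        Nat.card_fin]
    have e3 : Disjoint (Sum.inl '' Q : Set (XD G x ⊕ Fin n)) (Set.range Sum.inr) := by
      rw [Set.disjoint_left]
      rintro _ ⟨d, -, rfl⟩ ⟨j, hj⟩
      cases hj
    have e4 : Disjoint ((Sum.inl '' Q : Set (XD G x ⊕ Fin n)) ∪ Set.range Sum.inr) N1 := by
      rw [Set.disjoint_left]
      rintro _ (⟨d, hd, rfl⟩ | ⟨j, rfl⟩) hN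
      · exact hN.2 hd.2
      · exact hN.2 (hinr j)
    have e5 := Set.ncard_union_eq e3
    have e6 := Set.ncard_union_eq e4
    have e7 : (Sum.inl '' Q ∪ Set.range Sum.inr) ∪ N1 ⊆ U := by
      rintro _ ((⟨d, hd, rfl⟩ | ⟨j, rfl⟩) | hN)
      · exact hd.1
      · exact hinr j
      · exact hN.1
    have e8 := Set.ncard_le_ncard e7 (Set.toFinite U)
    omega
  have hc2 : B.ncard ≤ A.ncard + N1.ncard := by
    have e1 : (Sum.inl '' A : Set (XD G x ⊕ Fin n)).ncard = A.ncard :=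
      Set.ncard_image_of_injective _ Sum.inl_injective
    have e2 : (xcGW '' N1).ncard ≤ N1.ncard := Set.ncard_image_le
    have e3 : B ⊆ Sum.inl '' A ∪ xcGW '' N1 := by
      rintro w ⟨hw, h⟩
      rcases h with h | h
      · left
        rcases w with d | j
        · refine ⟨d, ?_, rfl⟩
          have : xcG d = d := by simpa [xcGW] using h
          exact xcG_fix.1 this
        · exact absurd (hinr j) hw
      · right
        exact ⟨xcGW w, ⟨h, by rwa [xcGW_invol]⟩, xcGW_invol w⟩
    have e4 := Set.ncard_le_ncard e3
    have e5 := Set.ncard_union_le (Sum.inl '' A) (xcGW '' N1)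
    omega
  have hc3 : B1.ncard ≤ (B \ R).ncard := by
    have : (Sum.inl '' B1 : Set (XD G x ⊕ Fin n)).ncard = B1.ncard :=
      Set.ncard_image_of_injective _ Sum.inl_injective
    rw [← this]
    refine Set.ncard_le_ncard ?_ (Set.toFinite _)
    rintro _ ⟨d, hd, rfl⟩; exact hd
  refine ⟨(fun d : XD G x => d.1.edge) '' (Q ∪ B1), ?_, ?_, ?_⟩
  · rintro _ ⟨d, -, rfl⟩; exact d.1.edge_mem
  · have h1 := Set.ncard_image_le (f := fun d : XD G x => d.1.edge) (Set.toFinite (Q ∪ B1))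
    have h2 := Set.ncard_union_le Q B1
    omega
  set X := (fun d : XD G x => d.1.edge) '' (Q ∪ B1) with hX
  have hXQ : ∀ d : XD G x, d.1.edge ∉ X → Sum.inl d ∈ U → Sum.inl (xcG d) ∉ U :=
    fun d hd h1 h2 => hd ⟨d, Or.inl ⟨h1, h2⟩, rfl⟩
  have hXB : ∀ d : XD G x, d.1.edge ∉ X → Sum.inl d ∈ B → Sum.inl d ∈ R := by
    intro d hd h1
    by_contra h2
    exact hd ⟨d, Or.inr ⟨h1, h2⟩, rfl⟩
  have hRinj : ∀ a ∈ R, ∀ b ∈ R, comp a = comp b → a = b := by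
    rintro _ ⟨c, hc, rfl⟩ _ ⟨c', hc', rfl⟩ h
    rw [hrc c hc, hrc c' hc'] at h
    rw [h]
  intro c ⟨ht, hpos, hinner⟩
  by_contra hodd
  rw [Nat.not_even_iff_odd] at hodd
  set v := c.getVert with hv
  have hv0 : v 0 = x := c.getVert_zero
  have hvL : v c.length = x := c.getVert_length
  have hadj : ∀ i < c.length, G.Adj (v i) (v (i + 1)) ∧ s(v i, v (i + 1)) ∉ X := by
    intro i hi
    have := c.adj_getVert_succ hi
    rwa [SimpleGraph.deleteEdges_adj] at this
  have hL1 : c.length ≠ 1 := by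
    intro h
    have h1 := (hadj 0 (by omega)).1
    rw [h] at hvL
    rw [hv0, zero_add, hvL] at h1
    exact h1.ne rfl
  have inv : ∀ i < c.length, ∃ d : XD G x,
      d.1.toProd = (if Even i then (v (i + 1), v i) else (v i, v (i + 1))) ∧ Sum.inl d ∉ U ∧
      ∃ j ≤ i, ∃ b : XD G x, Sum.inl b ∈ B ∧ b.1.edge = s(v j, v (j + 1)) ∧
        comp (Sum.inl b) = comp (Sum.inl d) := by
    intro i
    induction i with
    | zero =>
      intro _
      have h1 := hadj 0 hpos
      let d : XD G x := ⟨⟨(v (0 + 1), v 0), h1.1.symm⟩, hinner (0 + 1) (by omega) (by omega)⟩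
      have hde : d.1.edge = s(v 0, v (0 + 1)) := Sym2.eq_swap
      have hdx : xcG d = d := xcG_pos hv0
      have hdU : Sum.inl d ∉ U := by
        intro h
        have := hXQ d (by rw [hde]; exact h1.2) h
        rw [hdx] at this
        exact this h
      refine ⟨d, by simp [d], hdU, 0, le_rfl, d, ⟨hdU, Or.inl ?_⟩, hde, rfl⟩
      simp [xcGW, hdx]
    | succ i ih =>
      intro hi
      obtain ⟨d, hd, hdU, j, hj, b, hbB, hbe, hbc⟩ := ih (by omega)
      have h1 := hadj (i + 1) hi
      obtain ⟨a, haH, hae, has⟩ : ∃ a : XD G x, (XCH G x n).Adj (Sum.inl d) (Sum.inl a) ∧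
          a.1.edge = s(v (i + 1), v (i + 1 + 1)) ∧ a.1.symm.toProd =
            (if Even (i + 1) then (v (i + 1 + 1), v (i + 1)) else (v (i + 1), v (i + 1 + 1))) := by
        by_cases hp : Even i
        · have hp' : ¬ Even (i + 1) := by grind
          have hlt : i + 1 + 1 < c.length := by grind
          rw [if_pos hp] at hd
          refine ⟨⟨⟨(v (i + 1 + 1), v (i + 1)), h1.1.symm⟩, hinner _ (by omega) hlt⟩, ?_,
            Sym2.eq_swap, ?_⟩
          · rw [XCH_inl]
            right
            exact (congrArg Prod.fst hd).symm
          · rw [if_neg hp']; rfl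
        · have hp' : Even (i + 1) := by grind
          rw [if_neg hp] at hd
          refine ⟨⟨⟨(v (i + 1), v (i + 1 + 1)), h1.1⟩, hinner _ (by omega) hi⟩, ?_, rfl, ?_⟩
          · rw [XCH_inl]
            left
            exact congrArg Prod.snd hd
          · rw [if_pos hp']; rfl
      have haX : a.1.edge ∉ X := by rw [hae]; exact h1.2
      by_cases haU : Sum.inl a ∈ U
      · have h2 := hXQ a haX haU
        have h3 : a.1.snd ≠ x := by
          intro h
          rw [xcG_pos h] at h2
          exact h2 haU
        refine ⟨xcG a, by rw [xcG_neg h3, has], h2, i + 1, le_rfl, xcG a, ⟨h2, Or.inr ?_⟩, ?_, rfl⟩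
        · simpa [xcGW, xcG_invol] using haU
        · rw [xcG_neg h3, SimpleGraph.Dart.edge_symm, hae]
      · have h2 : comp (Sum.inl d) = comp (Sum.inl a) := hcomp _ _ hdU haU haH
        have haB : Sum.inl a ∉ B := by
          intro haB
          have r1 := hXB a haX haB
          have r2 := hXB b (by rw [hbe]; exact (hadj j (by omega)).2) hbB
          have r3 := Sum.inl_injective (hRinj _ r2 _ r1 (hbc.trans h2))
          rw [r3, hae] at hbe
          have := xc_trail_inj c ht hi (by omega) hbe
          omega
        have h3 : a.1.snd ≠ x := by
          intro h
          apply haB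
          exact ⟨haU, Or.inl (by simp [xcGW, xcG_pos h])⟩
        have h4 : Sum.inl (xcG a) ∉ U := by
          intro h
          exact haB ⟨haU, Or.inr h⟩
        refine ⟨xcG a, by rw [xcG_neg h3, has], h4, j, by omega, b, hbB, hbe, ?_⟩
        rw [hbc, h2]
        exact hcomp _ _ haU h4 (XCH_adj_g a h3)
  obtain ⟨d, hd, -⟩ := inv (c.length - 1) (by omega)
  have hp : Even (c.length - 1) := by grind
  rw [if_pos hp, Nat.sub_add_cancel hpos] at hd
  have := congrArg Prod.fst hd
  exact d.2 (this.trans hvL)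

/-- Erdős–Pósa for odd x-circuits: either there are k pairwise edge-disjoint
odd x-circuits, or at most 2k − 2 edges can be deleted so that every remaining x-circuit
has even length. -/
theorem odd_xCircuits_erdos_posa {V : Type*} [Fintype V] (G : SimpleGraph V)
    (k : ℕ) (hk : 1 ≤ k) (x : V) :
    (∃ f : Fin k → G.Walk x x, (∀ i, IsXCircuit (f i) ∧ Odd (f i).length) ∧
      ∀ i j, i ≠ j → List.Disjoint (f i).edges (f j).edges) ∨
    (∃ X ⊆ G.edgeSet, X.ncard ≤ 2 * k - 2 ∧
      ∀ (c : (G.deleteEdges X).Walk x x), IsXCircuit c → Even c.length) := by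
  rcases Nat.lt_or_ge ({d : XD G x | d.1.snd = x}.ncard) (2 * k) with h | h
  · exact Or.inr (xc_small G x k h)
  · obtain ⟨n, hn⟩ := Nat.exists_eq_add_of_le h
    by_cases hM : ∃ M : (XCH G x n).Subgraph, M.IsPerfectMatching
    · obtain ⟨M, hM⟩ := hM
      exact Or.inl (xc_pack G x n k hn M hM)
    · exact Or.inr (xc_hit G x n k hn (fun M h => hM ⟨M, h⟩))
end

section
/- Let t ≥ 49 be an integer and let G be a finite simple graph that admits a totally even immersion of K_{1400t} with set of branch vertices S ⊆ V(G). Suppose there is a collection of 3500·t² pairwise edge-disjoint odd trails in G, each of whose two ends lies in S, such that each vertex of S occurs as an end of at most 20t of these trails (where a closed trail with both ends at a vertex v counts twice towards v). Then G admits a totally odd immersion of K_t. -/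
open SimpleGraph

namespace OddImm

section
open Classical

/-- Number of colour changes along a list. -/
noncomputable def chg {γ : Type*} : List γ → ℕ
  | [] => 0
  | [_] => 0
  | x :: y :: l => (if x = y then 0 else 1) + chg (y :: l)

theorem chg_append_ge {γ : Type*} (l₁ l₂ : List γ) : chg l₁ + chg l₂ ≤ chg (l₁ ++ l₂) := by
  induction l₁ with
  | nil => simp [chg]
  | cons x l ih =>
    cases l with
    | nil => cases l₂ <;> simp [chg]
    | cons y l => simp only [List.cons_append, chg] at *; omega

theorem chg_append_le {γ : Type*} (l₁ l₂ : List γ) : chg (l₁ ++ l₂) ≤ chg l₁ + chg l₂ + 1 := by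
  induction l₁ with
  | nil => simp [chg]
  | cons x l ih =>
    cases l with
    | nil =>
      cases l₂ with
      | nil => simp [chg]
      | cons z l => simp only [List.cons_append, List.nil_append, chg]; split_ifs <;> omega
    | cons y l => simp only [List.cons_append, chg] at *; omega

theorem chg_const {γ : Type*} (c : γ) (l : List γ) (h : ∀ x ∈ l, x = c) : chg l = 0 := by
  induction l with
  | nil => simp [chg]
  | cons x l ih =>
    cases l with
    | nil => simp [chg]
    | cons y l =>
      have hx := h x (by simp)
      have hy := h y (by simp)
      have := ih (fun z hz => h z (List.mem_cons_of_mem _ hz))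
      simp only [chg, this]; simp [hx, hy]

theorem card_le_chg {γ : Type*} (l : List γ) : l.toFinset.card ≤ chg l + 1 := by
  induction l with
  | nil => simp [chg]
  | cons x l ih =>
    cases l with
    | nil => simp [chg]
    | cons y l =>
      simp only [chg]
      split_ifs with h
      · subst h
        have : (x :: x :: l).toFinset = (x :: l).toFinset := by ext; simp
        rw [this]; omega
      · have : (x :: y :: l).toFinset = insert x (y :: l).toFinset := by simp
        rw [this]
        have := Finset.card_insert_le x (y :: l).toFinset
        omega

theorem isTrail_append {V : Type*} {G : SimpleGraph V} {u v w : V} (p : G.Walk u v)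
    (q : G.Walk v w) (hp : p.IsTrail) (hq : q.IsTrail) (h : List.Disjoint p.edges q.edges) :
    (p.append q).IsTrail := by
  rw [Walk.isTrail_def, Walk.edges_append, List.nodup_append']
  exact ⟨hp.edges_nodup, hq.edges_nodup, h⟩

/-- First hit of a walk on a set of edges. -/
theorem exists_leg {V : Type*} {G : SimpleGraph V} {u v : V} (P : G.Walk u v) (X : Set (Sym2 V))
    (h : ∃ e ∈ P.edges, e ∈ X) :
    ∃ (w : V) (Q : G.Walk u w), Q.edges.Sublist P.edges ∧ (∀ e ∈ Q.edges, e ∉ X) ∧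
      ∃ e ∈ P.edges, e ∈ X ∧ w ∈ e := by
  induction P with
  | nil => simp at h
  | @cons u v w hadj p ih =>
    by_cases hX : s(u, v) ∈ X
    · exact ⟨u, Walk.nil, by simp, by simp, s(u, v), by simp, hX, by simp⟩
    · obtain ⟨e, he, heX⟩ := h
      have he' : e ∈ p.edges := by
        simp only [Walk.edges_cons, List.mem_cons] at he
        rcases he with rfl | he
        · exact absurd heX hX
        · exact he
      obtain ⟨w', Q, h1, h2, e', h3, h4, h5⟩ := ih ⟨e, he', heX⟩
      refine ⟨w', Walk.cons hadj Q, ?_, ?_, e', ?_, h4, h5⟩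
      · simpa using h1
      · intro f hf
        simp only [Walk.edges_cons, List.mem_cons] at hf
        rcases hf with rfl | hf
        · exact hX
        · exact h2 f hf
      · simp [h3]

theorem exists_pos {V : Type*} {G : SimpleGraph V} {x y : V} (T : G.Walk x y) (e : Sym2 V)
    (he : e ∈ T.edges) (w : V) (hw : w ∈ e) :
    ∃ k p : ℕ, (p = k ∨ p = k + 1) ∧ p ≤ T.length ∧ T.edges[k]? = some e ∧ T.getVert p = w := by
  induction T with
  | nil => simp at he
  | @cons u v w' hadj q ih =>
    simp only [Walk.edges_cons, List.mem_cons] at he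
    rcases he with rfl | he
    · rcases Sym2.mem_iff.1 hw with rfl | rfl
      · exact ⟨0, 0, by simp, by simp, by simp, by simp⟩
      · exact ⟨0, 1, by simp, by simp, by simp, by simp⟩
    · obtain ⟨k, p, h1, h2, h3, h4⟩ := ih he
      exact ⟨k + 1, p + 1, by omega, by simpa using h2, by simpa using h3, by simpa using h4⟩

/-- Legs of the right parity allow to shorten the tail of `T`. -/
theorem surgery_right {V γ : Type*} {G : SimpleGraph V} (col : Sym2 V → γ) {x y : V}
    (T : G.Walk x y) (hT : T.IsTrail) (R : Finset γ) (hR : 4 ≤ R.card)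
    (k p : γ → ℕ) (u : γ → V) (Q : ∀ c, G.Walk (u c) (T.getVert (p c)))
    (hkp : ∀ c ∈ R, p c = k c ∨ p c = k c + 1) (hp : ∀ c ∈ R, p c ≤ T.length)
    (hk : ∀ c ∈ R, ∃ e, T.edges[k c]? = some e ∧ col e = c)
    (hQ : ∀ c ∈ R, (Q c).IsTrail) (hQc : ∀ c ∈ R, ∀ e ∈ (Q c).edges, col e = c)
    (hQT : ∀ c ∈ R, ∀ e ∈ (Q c).edges, e ∉ T.edges)
    (hodd : ∀ c ∈ R, Odd ((Q c).length + p c)) :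
    ∃ c ∈ R, ∃ W : G.Walk x (u c), W.IsTrail ∧ Odd W.length ∧
      (∀ e ∈ W.edges, e ∈ T.edges ∨ e ∈ (Q c).edges) ∧
      chg (W.edges.map col) < chg (T.edges.map col) := by
  obtain ⟨c, hc, hmin⟩ := R.exists_min_image p (Finset.card_pos.1 (by omega))
  refine ⟨c, hc, (T.take (p c)).append (Q c).reverse, ?_, ?_, ?_, ?_⟩
  · apply isTrail_append
    · rw [Walk.isTrail_def, Walk.edges_take]
      exact hT.edges_nodup.sublist (List.take_sublist _ _)
    · exact (hQ c hc).reverse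
    · intro e he he'
      rw [Walk.edges_take] at he
      rw [Walk.edges_reverse, List.mem_reverse] at he'
      exact hQT c hc e he' (List.mem_of_mem_take he)
  · rw [Walk.length_append, Walk.take_length, Walk.length_reverse, min_eq_left (hp c hc), add_comm]
    exact hodd c hc
  · intro e he
    rw [Walk.edges_append, List.mem_append, Walk.edges_take, Walk.edges_reverse,
      List.mem_reverse] at he
    rcases he with he | he
    · exact Or.inl (List.mem_of_mem_take he)
    · exact Or.inr he
  · have hsplit : T.edges.map col = (T.edges.take (p c)).map col ++ (T.edges.drop (p c)).map col := by
      rw [← List.map_append, List.take_append_drop]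
    have h1 := chg_append_ge ((T.edges.take (p c)).map col) ((T.edges.drop (p c)).map col)
    rw [← hsplit] at h1
    have h2 := chg_append_le ((T.edges.take (p c)).map col) ((Q c).reverse.edges.map col)
    have h3 : chg ((Q c).reverse.edges.map col) = 0 := by
      apply chg_const c
      intro z hz
      rw [List.mem_map] at hz
      obtain ⟨e, he, rfl⟩ := hz
      rw [Walk.edges_reverse, List.mem_reverse] at he
      exact hQc c hc e he
    have h4 := card_le_chg ((T.edges.drop (p c)).map col)
    have h5 : R.card - 1 ≤ ((T.edges.drop (p c)).map col).toFinset.card := by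
      by_cases hex : ∃ d ∈ R, k d < p c
      · obtain ⟨d, hd, hdk⟩ := hex
        rw [← Finset.card_erase_of_mem hd]
        apply Finset.card_le_card
        intro d' hd'
        rw [Finset.mem_erase] at hd'
        obtain ⟨hne, hd'⟩ := hd'
        obtain ⟨e', he', hce'⟩ := hk d' hd'
        obtain ⟨e, he, hce⟩ := hk d hd
        have m1 := hmin d hd
        have m2 := hmin d' hd'
        have m3 := hkp d hd
        have m4 := hkp d' hd'
        have : p c ≤ k d' := by
          by_contra hlt
          have : k d' = k d := by omega
          rw [this, he] at he'
          simp only [Option.some.injEq] at he'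
          exact hne (by rw [← hce', ← hce, he'])
        rw [List.mem_toFinset, List.mem_map]
        refine ⟨e', ?_, hce'⟩
        rw [List.mem_iff_getElem?]
        refine ⟨k d' - p c, ?_⟩
        rw [List.getElem?_drop, Nat.add_sub_cancel' this, he']
      · push Not at hex
        refine le_trans (Nat.sub_le _ _) (Finset.card_le_card ?_)
        intro d' hd'
        obtain ⟨e', he', hce'⟩ := hk d' hd'
        have := hex d' hd'
        rw [List.mem_toFinset, List.mem_map]
        refine ⟨e', ?_, hce'⟩
        rw [List.mem_iff_getElem?]
        refine ⟨k d' - p c, ?_⟩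
        rw [List.getElem?_drop, Nat.add_sub_cancel' this, he']
    rw [Walk.edges_append, List.map_append, Walk.edges_take]
    omega

/-- Legs of the other parity allow to shorten the head of `T`. -/
theorem surgery_left {V γ : Type*} {G : SimpleGraph V} (col : Sym2 V → γ) {x y : V}
    (T : G.Walk x y) (hT : T.IsTrail) (hTo : Odd T.length) (R : Finset γ) (hR : 4 ≤ R.card)
    (k p : γ → ℕ) (u : γ → V) (Q : ∀ c, G.Walk (u c) (T.getVert (p c)))
    (hkp : ∀ c ∈ R, p c = k c ∨ p c = k c + 1) (hp : ∀ c ∈ R, p c ≤ T.length)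
    (hk : ∀ c ∈ R, ∃ e, T.edges[k c]? = some e ∧ col e = c)
    (hQ : ∀ c ∈ R, (Q c).IsTrail) (hQc : ∀ c ∈ R, ∀ e ∈ (Q c).edges, col e = c)
    (hQT : ∀ c ∈ R, ∀ e ∈ (Q c).edges, e ∉ T.edges)
    (hev : ∀ c ∈ R, ¬ Odd ((Q c).length + p c)) :
    ∃ c ∈ R, ∃ W : G.Walk (u c) y, W.IsTrail ∧ Odd W.length ∧
      (∀ e ∈ W.edges, e ∈ T.edges ∨ e ∈ (Q c).edges) ∧
      chg (W.edges.map col) < chg (T.edges.map col) := by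
  obtain ⟨c, hc, hmax⟩ := R.exists_max_image p (Finset.card_pos.1 (by omega))
  refine ⟨c, hc, (Q c).append (T.drop (p c)), ?_, ?_, ?_, ?_⟩
  · apply isTrail_append
    · exact hQ c hc
    · rw [Walk.isTrail_def, Walk.edges_drop]
      exact hT.edges_nodup.sublist (List.drop_sublist _ _)
    · intro e he' he
      rw [Walk.edges_drop] at he
      exact hQT c hc e he' (List.mem_of_mem_drop he)
  · rw [Walk.length_append, Walk.drop_length]
    have := hev c hc
    have h2 := hp c hc
    rw [Nat.odd_iff] at *
    omega
  · intro e he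
    rw [Walk.edges_append, List.mem_append, Walk.edges_drop] at he
    rcases he with he | he
    · exact Or.inr he
    · exact Or.inl (List.mem_of_mem_drop he)
  · have hsplit : T.edges.map col = (T.edges.take (p c)).map col ++ (T.edges.drop (p c)).map col := by
      rw [← List.map_append, List.take_append_drop]
    have h1 := chg_append_ge ((T.edges.take (p c)).map col) ((T.edges.drop (p c)).map col)
    rw [← hsplit] at h1
    have h2 := chg_append_le ((Q c).edges.map col) ((T.edges.drop (p c)).map col)
    have h3 : chg ((Q c).edges.map col) = 0 := by
      apply chg_const c
      intro z hz
      rw [List.mem_map] at hz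
      obtain ⟨e, he, rfl⟩ := hz
      exact hQc c hc e he
    have h4 := card_le_chg ((T.edges.take (p c)).map col)
    have h5 : R.card - 1 ≤ ((T.edges.take (p c)).map col).toFinset.card := by
      have key : ∀ d ∈ R, k d < p c → d ∈ ((T.edges.take (p c)).map col).toFinset := by
        intro d hd hlt
        obtain ⟨e, he, hce⟩ := hk d hd
        rw [List.mem_toFinset, List.mem_map]
        refine ⟨e, ?_, hce⟩
        rw [List.mem_iff_getElem?]
        exact ⟨k d, by rw [List.getElem?_take, if_pos hlt, he]⟩
      by_cases hex : ∃ d ∈ R, p c ≤ k d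
      · obtain ⟨d, hd, hdk⟩ := hex
        rw [← Finset.card_erase_of_mem hd]
        apply Finset.card_le_card
        intro d' hd'
        rw [Finset.mem_erase] at hd'
        obtain ⟨hne, hd'⟩ := hd'
        apply key d' hd'
        obtain ⟨e', he', hce'⟩ := hk d' hd'
        obtain ⟨e, he, hce⟩ := hk d hd
        have m1 := hmax d hd
        have m2 := hmax d' hd'
        have m3 := hkp d hd
        have m4 := hkp d' hd'
        by_contra hlt
        have : k d' = k d := by omega
        rw [this, he] at he'
        simp only [Option.some.injEq] at he'
        exact hne (by rw [← hce', ← hce, he'])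
      · push Not at hex
        exact le_trans (Nat.sub_le _ _) (Finset.card_le_card fun d hd => key d hd (hex d hd))
    rw [Walk.edges_append, List.map_append, Walk.edges_drop]
    omega

variable {V N : Type*} {G : SimpleGraph V}

/-- A walk between two branch vertices. -/
abbrev Tr (I : Immersion G (⊤ : SimpleGraph N)) := Σ p : N × N, G.Walk (I.φ p.1) (I.φ p.2)

/-- Number of ends of a pair at `s`. -/
noncomputable def ends (p : N × N) (s : N) : ℕ :=
  (if p.1 = s then 1 else 0) + (if p.2 = s then 1 else 0)

/-- Number of ends of the family at `s`. -/
noncomputable def cnt {I : Immersion G (⊤ : SimpleGraph N)} {m : ℕ} (F : Fin m → Tr I) (s : N) : ℕ :=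
  ∑ i, ends (F i).1 s

/-- A family of edge-disjoint odd trails with bounded number of ends at each vertex. -/
structure IsFam {I : Immersion G (⊤ : SimpleGraph N)} {m : ℕ} (K : ℕ) (F : Fin m → Tr I) : Prop where
  trail : ∀ i, (F i).2.IsTrail
  odd : ∀ i, Odd (F i).2.length
  disj : ∀ i j, i ≠ j → List.Disjoint (F i).2.edges (F j).2.edges
  bound : ∀ s, cnt F s ≤ K

/-- Total number of colour changes. -/
noncomputable def meas {γ : Type*} (col : Sym2 V → γ) {I : Immersion G (⊤ : SimpleGraph N)} {m : ℕ}
    (F : Fin m → Tr I) : ℕ :=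
  ∑ i, chg ((F i).2.edges.map col)

theorem sum_update_aux {α : Type*} {m : ℕ} (F : Fin m → α) (i : Fin m) (X : α) (f : α → ℕ) :
    (∑ j, f (Function.update F i X j)) + f (F i) = (∑ j, f (F j)) + f X := by
  rw [← Finset.add_sum_erase _ _ (Finset.mem_univ i),
    ← Finset.add_sum_erase _ (fun j => f (F j)) (Finset.mem_univ i)]
  have : ∑ j ∈ Finset.univ.erase i, f (Function.update F i X j) =
      ∑ j ∈ Finset.univ.erase i, f (F j) := by
    apply Finset.sum_congr rfl
    intro j hj
    rw [Function.update_of_ne (Finset.ne_of_mem_erase hj)]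
  rw [this, Function.update_self]
  omega

theorem IsFam.replace {I : Immersion G (⊤ : SimpleGraph N)} {m K : ℕ} {F : Fin m → Tr I}
    (hF : IsFam K F) (i : Fin m) (X : Tr I) (hX : X.2.IsTrail) (hXo : Odd X.2.length)
    (hXd : ∀ j, j ≠ i → List.Disjoint X.2.edges (F j).2.edges) (u : N) (hu : cnt F u < K)
    (hends : ∀ s, ends X.1 s ≤ ends (F i).1 s + if s = u then 1 else 0) :
    IsFam K (Function.update F i X) := by
  refine ⟨?_, ?_, ?_, ?_⟩
  · intro j
    by_cases h : j = i
    · subst h; rw [Function.update_self]; exact hX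
    · rw [Function.update_of_ne h]; exact hF.trail j
  · intro j
    by_cases h : j = i
    · subst h; rw [Function.update_self]; exact hXo
    · rw [Function.update_of_ne h]; exact hF.odd j
  · intro j k hjk
    by_cases h : j = i
    · subst h
      rw [Function.update_self, Function.update_of_ne hjk.symm]
      exact hXd k hjk.symm
    · by_cases h' : k = i
      · subst h'
        rw [Function.update_self, Function.update_of_ne hjk]
        exact (hXd j hjk).symm
      · rw [Function.update_of_ne h, Function.update_of_ne h']
        exact hF.disj j k hjk
  · intro s
    have h1 := sum_update_aux F i X (fun Y => ends Y.1 s)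
    have h2 := hends s
    have h3 := hF.bound s
    unfold cnt at *
    split_ifs at h2 with hs
    · subst hs; omega
    · omega

/-- Colours touching an unsaturated vertex and hit by the family. -/
noncomputable def hitSet [Fintype N] (I : Immersion G (⊤ : SimpleGraph N)) {m : ℕ} (K : ℕ)
    (F : Fin m → Tr I) : Finset (Sym2 N) :=
  Finset.univ.filter fun c => ∃ (u v : N) (h : (⊤ : SimpleGraph N).Adj u v), c = s(u, v) ∧
    cnt F u < K ∧ ∃ e ∈ (I.trail h).edges, ∃ i, e ∈ (F i).2.edges

/-- `c` has a leg on the walk `T`. -/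
def LegOn {I : Immersion G (⊤ : SimpleGraph N)} {m : ℕ} (K : ℕ)
    (F : Fin m → Tr I) (col : Sym2 V → Sym2 N) (i : Fin m) (c : Sym2 N) : Prop :=
  ∃ (u : N) (k p : ℕ) (Q : G.Walk (I.φ u) ((F i).2.getVert p)), cnt F u < K ∧
    (p = k ∨ p = k + 1) ∧ p ≤ (F i).2.length ∧ (∃ e, (F i).2.edges[k]? = some e ∧ col e = c) ∧
    Q.IsTrail ∧ (∀ e ∈ Q.edges, col e = c) ∧ ∀ e ∈ Q.edges, ∀ j, e ∉ (F j).2.edges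

theorem hit_bound [Fintype N] (I : Immersion G (⊤ : SimpleGraph N)) {m : ℕ} (K : ℕ)
    (F : Fin m → Tr I) (hF : IsFam K F) (col : Sym2 V → Sym2 N)
    (hcol : ∀ (u v : N) (h : (⊤ : SimpleGraph N).Adj u v), ∀ e ∈ (I.trail h).edges, col e = s(u, v))
    (hmin : ∀ F' : Fin m → Tr I, IsFam K F' → meas col F ≤ meas col F') :
    (hitSet I K F).card ≤ m * 6 := by
  have hleg : ∀ c ∈ hitSet I K F, ∃ i, LegOn K F col i c := by
    intro c hc
    simp only [hitSet, Finset.mem_filter, Finset.mem_univ, true_and] at hc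
    obtain ⟨u, v, h, rfl, hu, e, he, hi⟩ := hc
    obtain ⟨w, Q, hs, hQ, e', he', ⟨i, hi⟩, hw⟩ :=
      exists_leg (I.trail h) {e | ∃ i, e ∈ (F i).2.edges} ⟨e, he, hi⟩
    obtain ⟨k, p, h1, h2, h3, rfl⟩ := exists_pos (F i).2 e' hi w hw
    refine ⟨i, u, k, p, Q, hu, h1, h2, ⟨e', h3, hcol u v h e' he'⟩, ?_, ?_, ?_⟩
    · rw [Walk.isTrail_def]
      exact (I.isTrail h).edges_nodup.sublist hs
    · intro f hf
      exact hcol u v h f (hs.subset hf)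
    · intro f hf j hj
      exact hQ f hf ⟨j, hj⟩
  have hfib : ∀ i : Fin m, ((hitSet I K F).filter fun c => LegOn K F col i c).card ≤ 6 := by
    intro i
    by_contra hlt
    set R := (hitSet I K F).filter fun c => LegOn K F col i c with hRdef
    have hex : ∀ c, ∃ (u : N) (k p : ℕ) (Q : G.Walk (I.φ u) ((F i).2.getVert p)), c ∈ R →
        (cnt F u < K ∧
        (p = k ∨ p = k + 1) ∧ p ≤ (F i).2.length ∧ (∃ e, (F i).2.edges[k]? = some e ∧ col e = c) ∧
        Q.IsTrail ∧ (∀ e ∈ Q.edges, col e = c) ∧ ∀ e ∈ Q.edges, ∀ j, e ∉ (F j).2.edges) := by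
      intro c
      by_cases hc : c ∈ R
      · obtain ⟨u, k, p, Q, h⟩ := (Finset.mem_filter.1 hc).2
        exact ⟨u, k, p, Q, fun _ => h⟩
      · exact ⟨(F i).1.1, 0, 0, Walk.nil.copy rfl (Walk.getVert_zero _).symm,
          fun h => absurd h hc⟩
    choose u k p Q hall using hex
    have final : ∀ (c : Sym2 N) (X : Tr I), c ∈ R → X.2.IsTrail → Odd X.2.length →
        (∀ e ∈ X.2.edges, e ∈ (F i).2.edges ∨ e ∈ (Q c).edges) →
        chg (X.2.edges.map col) < chg ((F i).2.edges.map col) →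
        (∀ s, ends X.1 s ≤ ends (F i).1 s + if s = u c then 1 else 0) → False := by
      intro c X hc hX hXo hXe hch hends
      obtain ⟨h1, -, -, -, -, -, h7⟩ := hall c hc
      have hfam := hF.replace i X hX hXo (by
        intro j hj e he he'
        rcases hXe e he with h | h
        · exact hF.disj j i hj he' h
        · exact h7 e h j he') (u c) h1 hends
      have h2 := hmin _ hfam
      have h3 := sum_update_aux F i X (fun Y => chg (Y.2.edges.map col))
      unfold meas at h2
      omega
    have hsum := Finset.card_filter_add_card_filter_not (s := R)
      (fun c => Odd ((Q c).length + p c))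
    have hcases : 4 ≤ (R.filter fun c => Odd ((Q c).length + p c)).card ∨
        4 ≤ (R.filter fun c => ¬ Odd ((Q c).length + p c)).card := by omega
    rcases hcases with h4 | h4
    · obtain ⟨c, hc, W, h1, h2, h3, h5⟩ := surgery_right col (F i).2 (hF.trail i) _ h4 k p
        (fun c => I.φ (u c)) Q
        (fun c hc => (hall c (Finset.mem_filter.1 hc).1).2.1)
        (fun c hc => (hall c (Finset.mem_filter.1 hc).1).2.2.1)
        (fun c hc => (hall c (Finset.mem_filter.1 hc).1).2.2.2.1)
        (fun c hc => (hall c (Finset.mem_filter.1 hc).1).2.2.2.2.1)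
        (fun c hc => (hall c (Finset.mem_filter.1 hc).1).2.2.2.2.2.1)
        (fun c hc e he => (hall c (Finset.mem_filter.1 hc).1).2.2.2.2.2.2 e he i)
        (fun c hc => (Finset.mem_filter.1 hc).2)
      refine final c ⟨((F i).1.1, u c), W⟩ (Finset.mem_filter.1 hc).1 h1 h2 h3 h5 ?_
      intro s
      unfold ends
      simp only [eq_comm (a := s)]
      omega
    · obtain ⟨c, hc, W, h1, h2, h3, h5⟩ := surgery_left col (F i).2 (hF.trail i) (hF.odd i) _ h4 k p
        (fun c => I.φ (u c)) Q
        (fun c hc => (hall c (Finset.mem_filter.1 hc).1).2.1)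
        (fun c hc => (hall c (Finset.mem_filter.1 hc).1).2.2.1)
        (fun c hc => (hall c (Finset.mem_filter.1 hc).1).2.2.2.1)
        (fun c hc => (hall c (Finset.mem_filter.1 hc).1).2.2.2.2.1)
        (fun c hc => (hall c (Finset.mem_filter.1 hc).1).2.2.2.2.2.1)
        (fun c hc e he => (hall c (Finset.mem_filter.1 hc).1).2.2.2.2.2.2 e he i)
        (fun c hc => (Finset.mem_filter.1 hc).2)
      refine final c ⟨(u c, (F i).1.2), W⟩ (Finset.mem_filter.1 hc).1 h1 h2 h3 h5 ?_
      intro s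
      unfold ends
      simp only [eq_comm (a := s)]
      omega
  have hsub : hitSet I K F ⊆
      (Finset.univ : Finset (Fin m)).biUnion
        fun i => (hitSet I K F).filter fun c => LegOn K F col i c := by
    intro c hc
    obtain ⟨i, hi⟩ := hleg c hc
    rw [Finset.mem_biUnion]
    exact ⟨i, Finset.mem_univ _, Finset.mem_filter.2 ⟨hc, hi⟩⟩
  calc _ ≤ _ := Finset.card_le_card hsub
    _ ≤ (Finset.univ : Finset (Fin m)).card * 6 := Finset.card_biUnion_le_card_mul _ _ _ fun i _ => hfib i
    _ = m * 6 := by simp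

theorem fib {α κ : Type*} (s : Finset α) (t : Finset κ) (g : α → κ) :
    ∑ j ∈ t, (s.filter fun i => g i = j).card = (s.filter fun i => g i ∈ t).card := by
  convert Finset.sum_card_fiberwise_eq_card_filter s t g

theorem greedy {J M : Type*} [Fintype J] [Fintype M] (σ ε : J → M) (L : J → Finset M) (t : ℕ)
    (ht : 0 < t) (hσ : ∀ s, (Finset.univ.filter fun k => σ k = s).card ≤ t)
    (hε : ∀ s, (Finset.univ.filter fun k => ε k = s).card ≤ 20 * t)
    (hJ : Fintype.card J ≤ t * t) (hL : ∀ j, 30 * t ≤ (L j).card) :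
    ∃ z : J → M, (∀ j, z j ∈ L j) ∧ ∀ j k, j ≠ k → (σ j = σ k → z j ≠ z k) ∧
      (ε j = ε k → z j ≠ z k) ∧ ¬ (z j = ε k ∧ z k = ε j) := by
  have hne : ∀ j, ∃ v, v ∈ L j := fun j => Finset.card_pos.1 (by have := hL j; omega)
  choose z0 hz0 using hne
  have main : ∀ A : Finset J, ∃ z : J → M, (∀ j, z j ∈ L j) ∧
      (∀ j ∈ A, ∀ k ∈ A, j ≠ k → (σ j = σ k → z j ≠ z k) ∧
      (ε j = ε k → z j ≠ z k) ∧ ¬ (z j = ε k ∧ z k = ε j)) ∧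
      ∀ s, (A.filter fun k => z k = s).card ≤ t := by
    intro A
    induction A using Finset.induction_on with
    | empty => exact ⟨z0, hz0, by simp, by simp⟩
    | insert j A hjA ih =>
      obtain ⟨z, h1, h2, h3⟩ := ih
      set overS : Finset M := Finset.univ.filter fun s => t ≤ (A.filter fun k => z k = s).card
        with hover
      have ho : overS.card ≤ t := by
        have e1 : overS.card * t ≤ ∑ s ∈ overS, (A.filter fun k => z k = s).card := by
          rw [← smul_eq_mul]
          apply Finset.card_nsmul_le_sum
          intro s hs
          exact (Finset.mem_filter.1 hs).2
        have e2 : ∑ s ∈ overS, (A.filter fun k => z k = s).card ≤ A.card := by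
          rw [fib A overS z]
          exact Finset.card_filter_le _ _
        have e3 : A.card ≤ t * t := le_trans (Finset.card_le_univ A) hJ
        exact Nat.le_of_mul_le_mul_right (le_trans e1 (le_trans e2 e3)) ht
      set f1 := (A.filter fun k => σ k = σ j).image z with hf1
      set f2 := (A.filter fun k => ε k = ε j).image z with hf2
      set f3 := (A.filter fun k => z k = ε j).image ε with hf3
      have c1 : f1.card ≤ t := le_trans Finset.card_image_le
        (le_trans (Finset.card_le_card (Finset.filter_subset_filter _ (Finset.subset_univ A)))
          (hσ (σ j)))
      have c2 : f2.card ≤ 20 * t := le_trans Finset.card_image_le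
        (le_trans (Finset.card_le_card (Finset.filter_subset_filter _ (Finset.subset_univ A)))
          (hε (ε j)))
      have c3 : f3.card ≤ t := le_trans Finset.card_image_le (h3 _)
      have hlt : (f1 ∪ f2 ∪ f3 ∪ overS).card < (L j).card := by
        have a1 := Finset.card_union_le (f1 ∪ f2 ∪ f3) overS
        have a2 := Finset.card_union_le (f1 ∪ f2) f3
        have a3 := Finset.card_union_le f1 f2
        have := hL j
        omega
      obtain ⟨v, hvL, hv⟩ := Finset.exists_mem_notMem_of_card_lt_card hlt
      simp only [Finset.mem_union, not_or] at hv
      obtain ⟨⟨⟨v1, v2⟩, v3⟩, v4⟩ := hv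
      have hzne : ∀ k ∈ A, Function.update z j v k = z k := by
        intro k hk
        exact Function.update_of_ne (by rintro rfl; exact hjA hk) _ _
      have hzj : Function.update z j v j = v := Function.update_self _ _ _
      have w1 : ∀ k ∈ A, σ k = σ j → z k ≠ v := by
        intro k hk h hz
        exact v1 (Finset.mem_image.2 ⟨k, Finset.mem_filter.2 ⟨hk, h⟩, hz⟩)
      have w2 : ∀ k ∈ A, ε k = ε j → z k ≠ v := by
        intro k hk h hz
        exact v2 (Finset.mem_image.2 ⟨k, Finset.mem_filter.2 ⟨hk, h⟩, hz⟩)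
      have w3 : ∀ k ∈ A, z k = ε j → ε k ≠ v := by
        intro k hk h hz
        exact v3 (Finset.mem_image.2 ⟨k, Finset.mem_filter.2 ⟨hk, h⟩, hz⟩)
      refine ⟨Function.update z j v, ?_, ?_, ?_⟩
      · intro k
        by_cases h : k = j
        · subst h; rw [hzj]; exact hvL
        · rw [Function.update_of_ne h]; exact h1 k
      · intro a ha b hb hab
        rw [Finset.mem_insert] at ha hb
        rcases ha with rfl | ha
        · rcases hb with rfl | hb
          · exact absurd rfl hab
          · rw [hzj, hzne b hb]
            exact ⟨fun h => (w1 b hb h.symm).symm, fun h => (w2 b hb h.symm).symm,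
              fun h => w3 b hb h.2 h.1.symm⟩
        · rcases hb with rfl | hb
          · rw [hzj, hzne a ha]
            exact ⟨fun h => w1 a ha h, fun h => w2 a ha h, fun h => w3 a ha h.1 h.2.symm⟩
          · rw [hzne a ha, hzne b hb]
            exact h2 a ha b hb hab
      · intro s
        have hfilt : (A.filter fun k => Function.update z j v k = s) = A.filter fun k => z k = s := by
          apply Finset.filter_congr
          intro k hk
          rw [hzne k hk]
        rw [Finset.filter_insert, hzj, hfilt]
        split_ifs with hs
        · subst hs
          have : ¬ t ≤ (A.filter fun k => z k = v).card := fun h =>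
            v4 (Finset.mem_filter.2 ⟨Finset.mem_univ _, h⟩)
          have := Finset.card_insert_le j (A.filter fun k => z k = v)
          omega
        · exact h3 s
  obtain ⟨z, h1, h2, -⟩ := main Finset.univ
  exact ⟨z, h1, fun j k hjk => h2 j (Finset.mem_univ _) k (Finset.mem_univ _) hjk⟩

theorem mkImmersion {V : Type*} {G : SimpleGraph V} {t : ℕ} (ψ : Fin t ↪ V)
    (W : ∀ x y : Fin t, x < y → G.Walk (ψ x) (ψ y))
    (hW : ∀ x y h, (W x y h).IsTrail) (hodd : ∀ x y h, Odd (W x y h).length)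
    (hdisj : ∀ x y h x' y' h', s(x, y) ≠ s(x', y') →
      List.Disjoint (W x y h).edges (W x' y' h').edges) :
    HasTotallyOddImmersion G (⊤ : SimpleGraph (Fin t)) := by
  have hgt : ∀ {u v : Fin t}, (⊤ : SimpleGraph (Fin t)).Adj u v → ¬ u < v → v < u := by
    intro u v h hlt
    exact lt_of_le_of_ne (not_lt.1 hlt) (Ne.symm h.ne)
  let W' : ∀ ⦃u v : Fin t⦄, (⊤ : SimpleGraph (Fin t)).Adj u v → G.Walk (ψ u) (ψ v) :=
    fun u v h => if hlt : u < v then W u v hlt else (W v u (hgt h hlt)).reverse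
  have hedge : ∀ ⦃u v : Fin t⦄ (h : (⊤ : SimpleGraph (Fin t)).Adj u v),
      ∃ (x y : Fin t) (hxy : x < y), s(u, v) = s(x, y) ∧
        (∀ e, e ∈ (W' h).edges ↔ e ∈ (W x y hxy).edges) ∧
        (W' h).length = (W x y hxy).length ∧ (W' h).IsTrail := by
    intro u v h
    by_cases hlt : u < v
    · refine ⟨u, v, hlt, rfl, ?_⟩
      have : W' h = W u v hlt := dif_pos hlt
      rw [this]
      exact ⟨fun e => Iff.rfl, rfl, hW _ _ _⟩
    · refine ⟨v, u, hgt h hlt, Sym2.eq_swap, ?_⟩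
      have : W' h = (W v u (hgt h hlt)).reverse := dif_neg hlt
      rw [this]
      exact ⟨fun e => by simp, by simp, (hW _ _ _).reverse⟩
  refine ⟨⟨ψ, W', ?_, ?_, ?_⟩, ?_⟩
  · intro u v h
    obtain ⟨x, y, hxy, -, -, -, h4⟩ := hedge h
    exact h4
  · intro u v h
    by_cases hlt : u < v
    · have h1 : W' h = W u v hlt := dif_pos hlt
      have h2 : W' h.symm = (W u v hlt).reverse := dif_neg (not_lt.2 hlt.le)
      rw [h1, h2]
    · have h1 : W' h = (W v u (hgt h hlt)).reverse := dif_neg hlt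
      have h2 : W' h.symm = W v u (hgt h hlt) := dif_pos (hgt h hlt)
      rw [h1, h2, Walk.reverse_reverse]
  · intro u v a b h h' hne e he he'
    obtain ⟨x, y, hxy, e1, e2, -, -⟩ := hedge h
    obtain ⟨x', y', hxy', e1', e2', -, -⟩ := hedge h'
    rw [e1, e1'] at hne
    exact hdisj _ _ _ _ _ _ hne ((e2 e).1 he) ((e2' e).1 he')
  · intro u v h
    obtain ⟨x, y, hxy, -, -, h3, -⟩ := hedge h
    change Odd (W' h).length
    rw [h3]
    exact hodd _ _ _

theorem exists_col [Nonempty N] (I : Immersion G (⊤ : SimpleGraph N)) :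
    ∃ col : Sym2 V → Sym2 N, ∀ (u v : N) (h : (⊤ : SimpleGraph N).Adj u v),
      ∀ e ∈ (I.trail h).edges, col e = s(u, v) := by
  have key : ∀ e : Sym2 V, ∃ c : Sym2 N, ∀ (u v : N) (h : (⊤ : SimpleGraph N).Adj u v),
      e ∈ (I.trail h).edges → c = s(u, v) := by
    intro e
    by_cases hex : ∃ (u v : N) (h : (⊤ : SimpleGraph N).Adj u v), e ∈ (I.trail h).edges
    · obtain ⟨u, v, h, he⟩ := hex
      refine ⟨s(u, v), fun a b h' he' => ?_⟩
      by_contra hne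
      exact I.disjoint h h' hne he he'
    · refine ⟨s(Classical.arbitrary N, Classical.arbitrary N), fun a b h' he' => ?_⟩
      exact absurd ⟨a, b, h', he'⟩ hex
  choose col hc using key
  exact ⟨col, fun u v h e he => hc e u v h he⟩

theorem exists_min {I : Immersion G (⊤ : SimpleGraph N)} {m K : ℕ} (col : Sym2 V → Sym2 N)
    (F : Fin m → Tr I) (hF : IsFam K F) :
    ∃ F : Fin m → Tr I, IsFam K F ∧ ∀ F' : Fin m → Tr I, IsFam K F' → meas col F ≤ meas col F' := by
  have hex : ∃ n, ∃ F : Fin m → Tr I, IsFam K F ∧ meas col F = n := ⟨_, F, hF, rfl⟩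
  obtain ⟨F1, h1, h2⟩ := Nat.find_spec hex
  refine ⟨F1, h1, fun F' hF' => ?_⟩
  rw [h2]
  exact Nat.find_min' hex ⟨F', hF', rfl⟩

theorem cnt_eq {I : Immersion G (⊤ : SimpleGraph N)} {m : ℕ} (F : Fin m → Tr I) (s : N) :
    cnt F s = (Finset.univ.filter fun i => (F i).1.1 = s).card +
      (Finset.univ.filter fun i => (F i).1.2 = s).card := by
  unfold cnt ends
  rw [Finset.sum_add_distrib, Finset.card_filter, Finset.card_filter]

/-- Indices with an end in `X` are few. -/
theorem card_touch {I : Immersion G (⊤ : SimpleGraph N)} {m : ℕ} (F : Fin m → Tr I) (X : Finset N)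
    (K : ℕ) (hK : ∀ s, cnt F s ≤ K) :
    (Finset.univ.filter fun i => ¬ ((F i).1.1 ∉ X ∧ (F i).1.2 ∉ X)).card ≤ X.card * K := by
  have h1 : (Finset.univ.filter fun i => ¬ ((F i).1.1 ∉ X ∧ (F i).1.2 ∉ X)) ⊆
      (Finset.univ.filter fun i => (F i).1.1 ∈ X) ∪ (Finset.univ.filter fun i => (F i).1.2 ∈ X) := by
    intro i hi
    simp only [Finset.mem_filter, Finset.mem_univ, true_and, Finset.mem_union] at *
    tauto
  have h2 : ∑ s ∈ X, cnt F s ≤ X.card * K := by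
    rw [← smul_eq_mul]
    exact Finset.sum_le_card_nsmul _ _ _ fun s _ => hK s
  have h3 : ∑ s ∈ X, cnt F s = (Finset.univ.filter fun i => (F i).1.1 ∈ X).card +
      (Finset.univ.filter fun i => (F i).1.2 ∈ X).card := by
    simp only [cnt_eq]
    rw [Finset.sum_add_distrib, fib Finset.univ X (fun i => (F i).1.1),
      fib Finset.univ X (fun i => (F i).1.2)]
  have h4 := Finset.card_le_card h1
  have h5 := Finset.card_union_le (Finset.univ.filter fun i => (F i).1.1 ∈ X)
    (Finset.univ.filter fun i => (F i).1.2 ∈ X)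
  omega

theorem sum_cnt [Fintype N] {I : Immersion G (⊤ : SimpleGraph N)} {m : ℕ} (F : Fin m → Tr I) :
    ∑ s, cnt F s = 2 * m := by
  simp only [cnt_eq]
  rw [Finset.sum_add_distrib, fib Finset.univ Finset.univ (fun i => (F i).1.1),
    fib Finset.univ Finset.univ (fun i => (F i).1.2)]
  simp; omega

theorem sum_deg [Fintype N] (H : Finset (Sym2 N)) (X : Finset N) :
    ∑ a ∈ X, (Finset.univ.filter fun u => s(a, u) ∈ H).card ≤ 2 * H.card := by
  set P : Finset (N × N) := Finset.univ.filter fun p => s(p.1, p.2) ∈ H with hP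
  have h1 : P.card ≤ 2 * H.card := by
    apply Finset.card_le_mul_card_image_of_maps_to (f := fun p : N × N => s(p.1, p.2))
    · intro p hp
      exact (Finset.mem_filter.1 hp).2
    · intro c hc
      induction c using Sym2.ind with
      | _ x y =>
        have : (P.filter fun p => s(p.1, p.2) = s(x, y)) ⊆ {(x, y), (y, x)} := by
          rintro ⟨p, q⟩ hpq
          have := (Finset.mem_filter.1 hpq).2
          simp only [Sym2.eq_iff] at this
          simp only [Finset.mem_insert, Finset.mem_singleton, Prod.mk.injEq]
          exact this
        exact le_trans (Finset.card_le_card this) Finset.card_le_two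
  have h2 : ∀ a ∈ X, (Finset.univ.filter fun u => s(a, u) ∈ H).card ≤
      (P.filter fun p => p.1 = a).card := by
    intro a _
    apply Finset.card_le_card_of_injOn (fun u => (a, u))
    · intro u hu
      have := (Finset.mem_filter.1 hu).2
      simp [hP, this]
    · intro u _ v _ h
      simpa using h
  calc _ ≤ _ := Finset.sum_le_sum h2
    _ = _ := fib P X Prod.fst
    _ ≤ P.card := Finset.card_filter_le _ _
    _ ≤ _ := h1

theorem core [Fintype N] (t : ℕ) (ht : 0 < t) (hN : Fintype.card N = 1400 * t)
    (I : Immersion G (⊤ : SimpleGraph N))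
    (hEven : ∀ ⦃u v : N⦄ (h : (⊤ : SimpleGraph N).Adj u v),
      Even (I.trail h).length)
    (F0 : Fin (100 * t ^ 2) → Tr I) (hF0 : IsFam (20 * t) F0) :
    HasTotallyOddImmersion G (⊤ : SimpleGraph (Fin t)) := by
  have hNe : Nonempty N := Fintype.card_pos_iff.1 (by omega)
  obtain ⟨col, hcol⟩ := exists_col I
  obtain ⟨F, hF, hmin⟩ := exists_min col F0 hF0
  have hHit := hit_bound I (20 * t) F hF col hcol hmin
  set H := hitSet I (20 * t) F with hH
  set U := Finset.univ.filter fun u => cnt F u < 20 * t with hU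
  have htt : 0 < t * t := Nat.mul_pos ht ht
  -- `U` is large
  have hUc : 1390 * t ≤ U.card := by
    have h1 : (Finset.univ.filter fun u => ¬ cnt F u < 20 * t).card * (20 * t) ≤
        ∑ s ∈ (Finset.univ.filter fun u => ¬ cnt F u < 20 * t), cnt F s := by
      rw [← smul_eq_mul]
      apply Finset.card_nsmul_le_sum
      intro s hs
      exact not_lt.1 (Finset.mem_filter.1 hs).2
    have h2 : ∑ s ∈ (Finset.univ.filter fun u => ¬ cnt F u < 20 * t), cnt F s ≤ ∑ s, cnt F s :=
      Finset.sum_le_sum_of_subset (Finset.subset_univ _)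
    rw [sum_cnt] at h2
    have h3 : (Finset.univ.filter fun u => ¬ cnt F u < 20 * t).card ≤ 10 * t := by
      have e : 2 * (100 * t ^ 2) = 10 * t * (20 * t) := by ring
      rw [e] at h2
      exact Nat.le_of_mul_le_mul_right (h1.trans h2) (Nat.mul_pos (by norm_num) ht)
    have h4 : U.card + (Finset.univ.filter fun u => ¬ cnt F u < 20 * t).card =
        (Finset.univ : Finset N).card := Finset.card_filter_add_card_filter_not _
    rw [Finset.card_univ, hN] at h4
    omega
  set bad := Finset.univ.filter fun a : N =>
    600 * t ≤ (Finset.univ.filter fun u => s(a, u) ∈ H).card with hbad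
  have hbadc : bad.card ≤ 2 * t := by
    have h1 : bad.card * (600 * t) ≤
        ∑ a ∈ bad, (Finset.univ.filter fun u => s(a, u) ∈ H).card := by
      rw [← smul_eq_mul]
      apply Finset.card_nsmul_le_sum
      intro s hs
      exact (Finset.mem_filter.1 hs).2
    have h2 := sum_deg H bad
    have h3 : 2 * H.card ≤ 2 * (100 * t ^ 2 * 6) := Nat.mul_le_mul_left 2 hHit
    have h4 : 2 * (100 * t ^ 2 * 6) = 2 * t * (600 * t) := by ring
    have h5 : bad.card * (600 * t) ≤ 2 * t * (600 * t) := by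
      rw [← h4]; exact h1.trans (h2.trans h3)
    exact Nat.le_of_mul_le_mul_right h5 (Nat.mul_pos (by norm_num) ht)
  -- the new branch vertices
  have hUb : t ≤ (U \ bad).card := by
    have := Finset.le_card_sdiff bad U
    omega
  obtain ⟨Bs, hBsub, hBcard⟩ := Finset.exists_subset_card_eq hUb
  let eB := (Finset.equivFinOfCardEq hBcard).symm
  let B : Fin t ↪ N := eB.toEmbedding.trans (Function.Embedding.subtype _)
  have hBmem : ∀ x, B x ∈ Bs := fun x => (eB x).2
  have hBbad : ∀ x, B x ∉ bad := fun x => (Finset.mem_sdiff.1 (hBsub (hBmem x))).2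
  -- good trails
  set X := bad ∪ Bs with hX
  have hXc : X.card ≤ 3 * t := by
    have : X.card ≤ bad.card + Bs.card := Finset.card_union_le _ _
    omega
  have htouch := card_touch F X (20 * t) hF.bound
  set good := Finset.univ.filter fun i => ((F i).1.1 ∉ X ∧ (F i).1.2 ∉ X) with hgood
  have hgoodc : t * t ≤ good.card := by
    have h4 : good.card + (Finset.univ.filter fun i => ¬ ((F i).1.1 ∉ X ∧ (F i).1.2 ∉ X)).card =
        (Finset.univ : Finset (Fin (100 * t ^ 2))).card :=
      Finset.card_filter_add_card_filter_not _
    rw [Finset.card_univ, Fintype.card_fin] at h4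
    have h5 : X.card * (20 * t) ≤ 3 * t * (20 * t) := Nat.mul_le_mul_right _ hXc
    have h6 : 3 * t * (20 * t) = 60 * (t * t) := by ring
    have h7 : 100 * t ^ 2 = 100 * (t * t) := by ring
    omega
  have hsym : Fintype.card (Sym2 (Fin t)) ≤ Fintype.card {i // i ∈ good} := by
    have h1 : Fintype.card (Sym2 (Fin t)) ≤ Fintype.card (Fin t × Fin t) := by
      apply Fintype.card_le_of_surjective (fun p : Fin t × Fin t => s(p.1, p.2))
      intro c
      induction c using Sym2.ind with
      | _ x y => exact ⟨(x, y), rfl⟩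
    simp only [Fintype.card_prod, Fintype.card_fin] at h1
    rw [Fintype.card_coe]
    omega
  obtain ⟨τ⟩ := Function.Embedding.nonempty_of_card_le hsym
  have hτ1 : ∀ c, (F (τ c).1).1.1 ∉ X := fun c => (Finset.mem_filter.1 (τ c).2).2.1
  have hτ2 : ∀ c, (F (τ c).1).1.2 ∉ X := fun c => (Finset.mem_filter.1 (τ c).2).2.2
  have hτinj : ∀ c d, (τ c).1 = (τ d).1 → c = d := fun c d h => τ.injective (Subtype.ext h)
  -- demands
  let σ : Fin t × Fin t → N := fun j => B j.1
  let ε : Fin t × Fin t → N := fun j =>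
    if j.1 < j.2 then (F (τ s(j.1, j.2)).1).1.1 else (F (τ s(j.1, j.2)).1).1.2
  have hεX : ∀ j, ε j ∉ X := by
    intro j
    simp only [ε]
    split_ifs
    · exact hτ1 _
    · exact hτ2 _
  have hεbad : ∀ j, ε j ∉ bad := fun j h => hεX j (Finset.mem_union_left _ h)
  have hεB : ∀ j, ε j ∉ Bs := fun j h => hεX j (Finset.mem_union_right _ h)
  have hσc : ∀ s, (Finset.univ.filter fun k => σ k = s).card ≤ t := by
    intro s
    have : (Finset.univ.filter fun k => σ k = s).card ≤ (Finset.univ : Finset (Fin t)).card := by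
      apply Finset.card_le_card_of_injOn (fun k => k.2)
      · intro k _; simp
      · intro k hk k' hk' h
        have a1 := (Finset.mem_filter.1 hk).2
        have a2 := (Finset.mem_filter.1 hk').2
        exact Prod.ext (B.injective (a1.trans a2.symm)) h
    simpa using this
  have hεc : ∀ s, (Finset.univ.filter fun k => ε k = s).card ≤ 20 * t := by
    intro s
    have hb := hF.bound s
    rw [cnt_eq] at hb
    have h1 : ((Finset.univ.filter fun k => ε k = s).filter fun k => k.1 < k.2).card ≤
        (Finset.univ.filter fun i => (F i).1.1 = s).card := by
      apply Finset.card_le_card_of_injOn (fun k => (τ s(k.1, k.2)).1)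
      · intro k hk
        have hk' := Finset.mem_filter.1 hk
        have := (Finset.mem_filter.1 hk'.1).2
        simp only [ε, if_pos hk'.2] at this
        simpa using this
      · intro k hk k' hk' h
        have a1 := (Finset.mem_filter.1 hk).2
        have a2 := (Finset.mem_filter.1 hk').2
        have := hτinj _ _ h
        rw [Sym2.eq_iff] at this
        rcases this with ⟨e1, e2⟩ | ⟨e1, e2⟩
        · exact Prod.ext e1 e2
        · rw [e1, e2] at a1
          exact absurd a1 (not_lt.2 a2.le)
    have h2 : ((Finset.univ.filter fun k => ε k = s).filter fun k => ¬ k.1 < k.2).card ≤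
        (Finset.univ.filter fun i => (F i).1.2 = s).card := by
      apply Finset.card_le_card_of_injOn (fun k => (τ s(k.1, k.2)).1)
      · intro k hk
        have hk' := Finset.mem_filter.1 hk
        have := (Finset.mem_filter.1 hk'.1).2
        simp only [ε, if_neg hk'.2] at this
        simpa using this
      · intro k hk k' hk' h
        have a1 := (Finset.mem_filter.1 hk).2
        have a2 := (Finset.mem_filter.1 hk').2
        have := hτinj _ _ h
        rw [Sym2.eq_iff] at this
        rcases this with ⟨e1, e2⟩ | ⟨e1, e2⟩
        · exact Prod.ext e1 e2
        · rw [e1, e2] at a1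
          have a3 := le_antisymm (not_lt.1 a1) (not_lt.1 a2)
          exact Prod.ext (by rw [e1, a3]) (by rw [e2, a3])
    have h3 := Finset.card_filter_add_card_filter_not (s := Finset.univ.filter fun k => ε k = s)
      (fun k => k.1 < k.2)
    omega
  let L : Fin t × Fin t → Finset N := fun j =>
    U \ (Bs ∪ (Finset.univ.filter fun u => s(σ j, u) ∈ H) ∪
      (Finset.univ.filter fun u => s(ε j, u) ∈ H) ∪ {ε j})
  have hLc : ∀ j, 30 * t ≤ (L j).card := by
    intro j
    have b1 : (Finset.univ.filter fun u => s(σ j, u) ∈ H).card < 600 * t := by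
      by_contra h
      exact hBbad j.1 (Finset.mem_filter.2 ⟨Finset.mem_univ _, not_lt.1 h⟩)
    have b2 : (Finset.univ.filter fun u => s(ε j, u) ∈ H).card < 600 * t := by
      by_contra h
      exact hεbad j (Finset.mem_filter.2 ⟨Finset.mem_univ _, not_lt.1 h⟩)
    have c0 := Finset.le_card_sdiff (Bs ∪ (Finset.univ.filter fun u => s(σ j, u) ∈ H) ∪
      (Finset.univ.filter fun u => s(ε j, u) ∈ H) ∪ {ε j}) U
    have c1 := Finset.card_union_le (Bs ∪ (Finset.univ.filter fun u => s(σ j, u) ∈ H) ∪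
      (Finset.univ.filter fun u => s(ε j, u) ∈ H)) {ε j}
    have c2 := Finset.card_union_le (Bs ∪ (Finset.univ.filter fun u => s(σ j, u) ∈ H))
      (Finset.univ.filter fun u => s(ε j, u) ∈ H)
    have c3 := Finset.card_union_le Bs (Finset.univ.filter fun u => s(σ j, u) ∈ H)
    rw [Finset.card_singleton] at c1
    simp only [L]
    omega
  obtain ⟨z, hzL, hz⟩ := greedy σ ε L t ht hσc hεc (by simp) hLc
  have hzU : ∀ j, cnt F (z j) < 20 * t := fun j =>
    (Finset.mem_filter.1 (Finset.mem_sdiff.1 (hzL j)).1).2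
  have hz' : ∀ j, z j ∉ Bs ∧ s(σ j, z j) ∉ H ∧ s(ε j, z j) ∉ H ∧ z j ≠ ε j := by
    intro j
    have := (Finset.mem_sdiff.1 (hzL j)).2
    simp only [Finset.mem_union, Finset.mem_filter, Finset.mem_univ, true_and,
      Finset.mem_singleton, not_or] at this
    tauto
  -- clean trails
  have hclean : ∀ (a v : N) (h : (⊤ : SimpleGraph N).Adj v a),
      cnt F v < 20 * t → s(a, v) ∉ H → ∀ e ∈ (I.trail h).edges, ∀ i, e ∉ (F i).2.edges := by
    intro a v h hv hH' e he i hi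
    apply hH'
    rw [hH, hitSet, Finset.mem_filter]
    exact ⟨Finset.mem_univ _, v, a, h, Sym2.eq_swap, hv, e, he, i, hi⟩
  let Own : Fin t × Fin t → Sym2 V → Prop := fun j e =>
    (∀ i, e ∉ (F i).2.edges) ∧ (col e = s(σ j, z j) ∨ col e = s(z j, ε j))
  have hOwn : ∀ j k e, Own j e → Own k e → j = k := by
    rintro j k e ⟨-, hj⟩ ⟨-, hk⟩
    by_contra hne
    obtain ⟨g1, g2, g3⟩ := hz j k hne
    have m1 := hBmem j.1
    have m2 := hBmem k.1
    rcases hj with hj | hj <;> rcases hk with hk | hk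
    · rw [hj, Sym2.eq_iff] at hk
      rcases hk with ⟨e1, e2⟩ | ⟨e1, e2⟩
      · exact g1 e1 e2
      · exact (hz' k).1 (e1 ▸ m1)
    · rw [hj, Sym2.eq_iff] at hk
      rcases hk with ⟨e1, e2⟩ | ⟨e1, e2⟩
      · exact (hz' k).1 (e1 ▸ m1)
      · exact hεB k (e1 ▸ m1)
    · rw [hj, Sym2.eq_iff] at hk
      rcases hk with ⟨e1, e2⟩ | ⟨e1, e2⟩
      · exact (hz' j).1 (e1 ▸ m2)
      · exact hεB j (e2 ▸ m2)
    · rw [hj, Sym2.eq_iff] at hk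
      rcases hk with ⟨e1, e2⟩ | ⟨e1, e2⟩
      · exact g2 e2 e1
      · exact g3 ⟨e1, e2.symm⟩
  have hroute : ∀ (j : Fin t × Fin t) (q : N), ε j = q →
      ∃ R : G.Walk (I.φ (B j.1)) (I.φ q), R.IsTrail ∧ Even R.length ∧ ∀ e ∈ R.edges, Own j e := by
    rintro j _ rfl
    obtain ⟨q1, q2, q3, q4⟩ := hz' j
    have hne1 : B j.1 ≠ z j := fun h => q1 (h ▸ hBmem j.1)
    have h1 : (⊤ : SimpleGraph N).Adj (B j.1) (z j) := by simpa using hne1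
    have h2 : (⊤ : SimpleGraph N).Adj (z j) (ε j) := by simpa using q4
    have hd : s(B j.1, z j) ≠ s(z j, ε j) := by
      intro h
      rw [Sym2.eq_iff] at h
      rcases h with ⟨e1, e2⟩ | ⟨e1, e2⟩
      · exact hne1 e1
      · exact hεB j (e1 ▸ hBmem j.1)
    refine ⟨(I.trail h1).append (I.trail h2), ?_, ?_, ?_⟩
    · exact isTrail_append _ _ (I.isTrail h1) (I.isTrail h2) (I.disjoint h1 h2 hd)
    · rw [Walk.length_append]
      exact (hEven h1).add (hEven h2)
    · intro e he
      rw [Walk.edges_append, List.mem_append] at he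
      rcases he with he | he
      · refine ⟨?_, Or.inl (hcol _ _ h1 e he)⟩
        apply hclean (B j.1) (z j) h1.symm (hzU j) q2
        rw [I.symm h1, Walk.edges_reverse, List.mem_reverse]
        exact he
      · refine ⟨?_, Or.inr (hcol _ _ h2 e he)⟩
        exact hclean (ε j) (z j) h2 (hzU j) q3 e he
  have hwalk : ∀ x y : Fin t, x < y → ∃ W : G.Walk (I.φ (B x)) (I.φ (B y)),
      W.IsTrail ∧ Odd W.length ∧ ∀ e ∈ W.edges,
        e ∈ (F (τ s(x, y)).1).2.edges ∨ Own (x, y) e ∨ Own (y, x) e := by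
    intro x y hxy
    obtain ⟨R1, a1, a2, a3⟩ := hroute (x, y) (F (τ s(x, y)).1).1.1 (by simp [ε, hxy])
    obtain ⟨R2, b1, b2, b3⟩ := hroute (y, x) (F (τ s(x, y)).1).1.2 (by
      simp only [ε, if_neg (not_lt.2 hxy.le)]
      rw [Sym2.eq_swap])
    refine ⟨R1.append ((F (τ s(x, y)).1).2.append R2.reverse), ?_, ?_, ?_⟩
    · apply isTrail_append _ _ a1
      · apply isTrail_append _ _ (hF.trail _) b1.reverse
        intro e he he'
        rw [Walk.edges_reverse, List.mem_reverse] at he'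
        exact (b3 e he').1 _ he
      · intro e he he'
        rw [Walk.edges_append, List.mem_append, Walk.edges_reverse, List.mem_reverse] at he'
        rcases he' with he' | he'
        · exact (a3 e he).1 _ he'
        · have := hOwn _ _ e (a3 e he) (b3 e he')
          rw [Prod.mk.injEq] at this
          exact hxy.ne this.1
    · rw [Walk.length_append, Walk.length_append, Walk.length_reverse]
      exact a2.add_odd ((hF.odd _).add_even b2)
    · intro e he
      rw [Walk.edges_append, Walk.edges_append, List.mem_append, List.mem_append,
        Walk.edges_reverse, List.mem_reverse] at he
      rcases he with he | he | he
      · exact Or.inr (Or.inl (a3 e he))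
      · exact Or.inl he
      · exact Or.inr (Or.inr (b3 e he))
  choose W hW1 hW2 hW3 using hwalk
  refine mkImmersion (B.trans I.φ) W hW1 hW2 ?_
  intro x y h x' y' h' hne e he he'
  have hno : ∀ j k, Own j e → Own k e → s(j.1, j.2) = s(x, y) → s(k.1, k.2) = s(x', y') → False := by
    intro j k hj hk e1 e2
    have := hOwn j k e hj hk
    subst this
    exact hne (e1.symm.trans e2)
  rcases hW3 x y h e he with g | g | g <;> rcases hW3 x' y' h' e he' with g' | g' | g'
  · by_cases hi : (τ s(x, y)).1 = (τ s(x', y')).1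
    · exact hne (hτinj _ _ hi)
    · exact hF.disj _ _ hi g g'
  · exact g'.1 _ g
  · exact g'.1 _ g
  · exact g.1 _ g'
  · exact hno _ _ g g' rfl rfl
  · exact hno _ _ g g' rfl Sym2.eq_swap
  · exact g.1 _ g'
  · exact hno _ _ g g' Sym2.eq_swap rfl
  · exact hno _ _ g g' Sym2.eq_swap Sym2.eq_swap

end

end OddImm

/-- Given a totally even K_{1400t}-immersion with branch vertex set S and a
collection of 3500t² pairwise edge-disjoint odd trails with both ends in S, each vertex of S
being an end of at most 20t of them (a closed trail counting twice), G admits a totally odd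
K_t-immersion. -/
theorem totally_odd_from_even_and_odd_trails {V : Type*} [Fintype V] [DecidableEq V]
    (t : ℕ) (ht : 49 ≤ t) (G : SimpleGraph V)
    (I : Immersion G (⊤ : SimpleGraph (Fin (1400 * t))))
    (hEven : ∀ ⦃u v : Fin (1400 * t)⦄ (h : (⊤ : SimpleGraph (Fin (1400 * t))).Adj u v),
      Even (I.trail h).length)
    (S : Set V) (hS : S = Set.range I.φ)
    (a b : Fin (3500 * t ^ 2) → V) (T : ∀ i, G.Walk (a i) (b i))
    (hTrail : ∀ i, (T i).IsTrail) (hOdd : ∀ i, Odd (T i).length)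
    (haS : ∀ i, a i ∈ S) (hbS : ∀ i, b i ∈ S)
    (hdisj : ∀ i j, i ≠ j → List.Disjoint (T i).edges (T j).edges)
    (hcount : ∀ v ∈ S,
      (Finset.univ.filter fun i => a i = v).card +
        (Finset.univ.filter fun i => b i = v).card ≤ 20 * t) :
    HasTotallyOddImmersion G (⊤ : SimpleGraph (Fin t)) := by
  classical
  subst hS
  choose a' ha' using haS
  choose b' hb' using hbS
  have hle : 100 * t ^ 2 ≤ 3500 * t ^ 2 := Nat.mul_le_mul_right _ (by norm_num)
  let ι : Fin (100 * t ^ 2) → Fin (3500 * t ^ 2) := Fin.castLE hle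
  have hι : Function.Injective ι := Fin.castLE_injective hle
  let F0 : Fin (100 * t ^ 2) → OddImm.Tr I := fun i =>
    ⟨(a' (ι i), b' (ι i)), (T (ι i)).copy (ha' _).symm (hb' _).symm⟩
  have hedges : ∀ i, (F0 i).2.edges = (T (ι i)).edges := fun i => Walk.edges_copy _ _ _
  have hlen : ∀ i, (F0 i).2.length = (T (ι i)).length := fun i => Walk.length_copy _ _ _
  refine OddImm.core t (by omega) (by simp) I hEven F0 ⟨?_, ?_, ?_, ?_⟩
  · intro i
    rw [Walk.isTrail_def, hedges]
    exact (hTrail _).edges_nodup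
  · intro i
    rw [hlen]
    exact hOdd _
  · intro i j hij
    rw [hedges, hedges]
    exact hdisj _ _ fun h => hij (hι h)
  · intro s
    rw [OddImm.cnt_eq]
    refine le_trans (Nat.add_le_add ?_ ?_) (hcount (I.φ s) ⟨s, rfl⟩)
    · apply Finset.card_le_card_of_injOn ι
      · intro i hi
        have h1 : a' (ι i) = s := by
          simp only [Finset.coe_filter, Set.mem_ofPred_eq, Finset.mem_univ, true_and] at hi
          exact hi
        have h2 : a (ι i) = I.φ s := by rw [← h1, ha']
        simpa using h2
      · exact hι.injOn
    · apply Finset.card_le_card_of_injOn ι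
      · intro i hi
        have h1 : b' (ι i) = s := by
          simp only [Finset.coe_filter, Set.mem_ofPred_eq, Finset.mem_univ, true_and] at hi
          exact hi
        have h2 : b (ι i) = I.φ s := by rw [← h1, hb']
        simpa using h2
      · exact hι.injOn
end
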